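/- arXiv:2112.02493 — 2 statements merged into one kernel-verified Lean document; each statement's English description precedes it below -/
import Mathlib

section
/- Let x = x̂ ⊗ t_λ ⊗ z_{−∞} with x̂ = (…, x_2, x_1) ∈ X+, and suppose that x* is extremal. Then γ_k·x_k − x_{k+1} ≥ 0 for every k ≥ 1. -/
open Filter Function

namespace HypCrystal

variable (a1 a2 k1 k2 : ℤ)

/-- `i_k`: 1 if `k` is odd, 2 if `k` is even. -/
def idx (k : ℤ) : ℤ := if k % 2 = 1 then 1 else 2

/-- membership in the index set `I = {1,2}`. -/
def IsI (i : ℤ) : Prop := i = 1 ∨ i = 2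

/-- `⟨α_{i_j}, α_{i_k}^∨⟩`. -/
def pairJK (j k : ℤ) : ℤ :=
  if j % 2 = k % 2 then 2 else if k % 2 = 1 then -a1 else -a2

/-- `⟨α_{i_j}, α_i^∨⟩` for `i ∈ {1,2}`. -/
def pairJI (j i : ℤ) : ℤ :=
  if idx j = i then 2 else if i = 1 then -a1 else -a2

/-- `α_{i_j}` in the `(Λ1, Λ2)`-coordinates. -/
def alphaOf (j : ℤ) : ℤ × ℤ := if j % 2 = 1 then (2, -a2) else (-a1, 2)

/-- `⟨ν, α_i^∨⟩` for a weight `ν` in `(Λ1, Λ2)`-coordinates. -/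
def pairW (ν : ℤ × ℤ) (i : ℤ) : ℤ := if i = 1 then ν.1 else ν.2

/-- the sequence `c_j`. -/
def cseq : ℕ → ℤ
  | 0 => 0
  | 1 => 1
  | j + 2 => (if j % 2 = 0 then a1 else a2) * cseq (j + 1) - cseq j

/-- the sequence `c'_j`. -/
def cseq' : ℕ → ℤ
  | 0 => 0
  | 1 => 1
  | j + 2 => (if j % 2 = 0 then a2 else a1) * cseq' (j + 1) - cseq' j

noncomputable def alphaR : ℝ :=
  ((a1 : ℝ) * a2 + Real.sqrt ((a1 : ℝ) ^ 2 * (a2 : ℝ) ^ 2 - 4 * a1 * a2)) / (2 * a2)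

noncomputable def betaR : ℝ :=
  ((a1 : ℝ) * a2 + Real.sqrt ((a1 : ℝ) ^ 2 * (a2 : ℝ) ^ 2 - 4 * a1 * a2)) / (2 * a1)

/-- `γ_k = α` if `k` even, `β` if `k` odd. -/
noncomputable def gammaR (k : ℤ) : ℝ := if k % 2 = 0 then alphaR a1 a2 else betaR a1 a2

/-- `p_m` for `m ≥ 0`. -/
def ppos : ℕ → ℤ
  | 0 => k2
  | 1 => k1
  | m + 2 => (if m % 2 = 0 then a2 else a1) * ppos (m + 1) - ppos m

/-- `p_{-n}` for `n ≥ 0`. -/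
def pneg : ℕ → ℤ
  | 0 => k2
  | 1 => a1 * k2 - k1
  | n + 2 => (if (n + 2) % 2 = 0 then a2 else a1) * pneg (n + 1) - pneg n

/-- the two-sided sequence `p_m`, `m ∈ ℤ`, with `p_0 = k2`, `p_1 = k1`. -/
def pseq (m : ℤ) : ℤ :=
  if 0 ≤ m then ppos a1 a2 k1 k2 m.toNat else pneg a1 a2 k1 k2 (-m).toNat

/-- `λ = k1·Λ1 − k2·Λ2` in `(Λ1, Λ2)`-coordinates. -/
def lamW : ℤ × ℤ := (k1, -k2)

/-- membership in `ℤ^{+∞}` (coordinates supported on positions `≥ 1`, nonnegative,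
finitely supported). -/
def ZPlusMem (x : ℤ → ℤ) : Prop :=
  (∀ k : ℤ, k ≤ 0 → x k = 0) ∧ (∀ k : ℤ, 0 ≤ x k) ∧ ∃ N : ℕ, ∀ k : ℤ, (N : ℤ) < k → x k = 0

/-- membership in `ℤ^{−∞}` (coordinates supported on positions `≤ 0`, nonpositive,
finitely supported). -/
def ZMinusMem (x : ℤ → ℤ) : Prop :=
  (∀ k : ℤ, 1 ≤ k → x k = 0) ∧ (∀ k : ℤ, x k ≤ 0) ∧ ∃ N : ℕ, ∀ k : ℤ, k < -(N : ℤ) → x k = 0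

/-- membership in `X+ = Img(Ψ⁺)`. -/
def XPlusMem (x : ℤ → ℤ) : Prop :=
  ZPlusMem x ∧ ∀ j : ℤ, 1 ≤ j →
    0 ≤ cseq a1 a2 j.toNat * x j - cseq a1 a2 (j - 1).toNat * x (j + 1)

/-- membership in `X− = Img(Ψ⁻)`. -/
def XMinusMem (x : ℤ → ℤ) : Prop :=
  ZMinusMem x ∧ ∀ j : ℤ, j ≤ 0 →
    cseq' a1 a2 (1 - j).toNat * x j - cseq' a1 a2 (-j).toNat * x (j - 1) ≤ 0

def posPart (x : ℤ → ℤ) : ℤ → ℤ := fun k => if 1 ≤ k then x k else 0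
def negPart (x : ℤ → ℤ) : ℤ → ℤ := fun k => if k ≤ 0 then x k else 0

/-- membership in `Z_ι(μ) = ℤ^{+∞} ⊗ t_μ ⊗ ℤ^{−∞}` (in coordinates). -/
def ZMem (x : ℤ → ℤ) : Prop := ZPlusMem (posPart x) ∧ ZMinusMem (negPart x)

/-- membership in `X+ ⊗ t_λ ⊗ X−` (in coordinates). -/
def XXMem (x : ℤ → ℤ) : Prop := XPlusMem a1 a2 (posPart x) ∧ XMinusMem a1 a2 (negPart x)

/-- `σ_k` on `ℤ^{+∞}` (for `k ≥ 1`). -/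
noncomputable def sigmaP (x : ℤ → ℤ) (k : ℤ) : ℤ :=
  x k + ∑ᶠ j : ℤ, if k < j then pairJK a1 a2 j k * x j else 0

/-- `σ_k` on `ℤ^{−∞}` (for `k ≤ 0`). -/
noncomputable def sigmaM (x : ℤ → ℤ) (k : ℤ) : ℤ :=
  -(x k) - ∑ᶠ j : ℤ, if j < k then pairJK a1 a2 j k * x j else 0

/-- `−Σ_j x_j α_{i_j}` in `(Λ1, Λ2)`-coordinates. -/
noncomputable def wtOf (x : ℤ → ℤ) : ℤ × ℤ :=
  (-∑ᶠ j : ℤ, x j * (alphaOf a1 a2 j).1, -∑ᶠ j : ℤ, x j * (alphaOf a1 a2 j).2)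

/-- `wt(x) = μ − Σ_j x_j α_{i_j}`. -/
noncomputable def wtZ (μ : ℤ × ℤ) (x : ℤ → ℤ) : ℤ × ℤ := μ + wtOf a1 a2 x

/-- `σ_k` on `Z_ι(μ)`. -/
noncomputable def sigmaZ (μ : ℤ × ℤ) (x : ℤ → ℤ) (k : ℤ) : ℤ :=
  if 1 ≤ k then sigmaP a1 a2 x k
  else sigmaM a1 a2 x k - pairW (wtZ a1 a2 μ x) (idx k)

/-- `ε_i` on `Z_ι(μ)`. -/
noncomputable def epsZ (μ : ℤ × ℤ) (x : ℤ → ℤ) (i : ℤ) : ℤ :=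
  sSup {s : ℤ | ∃ k : ℤ, idx k = i ∧ sigmaZ a1 a2 μ x k = s}

/-- `φ_i` on `Z_ι(μ)`. -/
noncomputable def phiZ (μ : ℤ × ℤ) (x : ℤ → ℤ) (i : ℤ) : ℤ :=
  epsZ a1 a2 μ x i + pairW (wtZ a1 a2 μ x) i

noncomputable def kmaxZ (μ : ℤ × ℤ) (x : ℤ → ℤ) (i : ℤ) : ℤ :=
  sSup {k : ℤ | idx k = i ∧ sigmaZ a1 a2 μ x k = epsZ a1 a2 μ x i}

noncomputable def kminZ (μ : ℤ × ℤ) (x : ℤ → ℤ) (i : ℤ) : ℤ :=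
  sInf {k : ℤ | idx k = i ∧ sigmaZ a1 a2 μ x k = epsZ a1 a2 μ x i}

/-- `ẽ_i` on `Z_ι(μ)`; `none` represents `0`. -/
noncomputable def eZ (μ : ℤ × ℤ) (i : ℤ) (x : ℤ → ℤ) : Option (ℤ → ℤ) :=
  if 0 < epsZ a1 a2 μ x i then
    some (Function.update x (kmaxZ a1 a2 μ x i) (x (kmaxZ a1 a2 μ x i) - 1))
  else none

/-- `f̃_i` on `Z_ι(μ)`; `none` represents `0`. -/
noncomputable def fZ (μ : ℤ × ℤ) (i : ℤ) (x : ℤ → ℤ) : Option (ℤ → ℤ) :=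
  if 0 < phiZ a1 a2 μ x i then
    some (Function.update x (kminZ a1 a2 μ x i) (x (kminZ a1 a2 μ x i) + 1))
  else none

/-- `ε_i` on `ℤ^{+∞}`. -/
noncomputable def epsP (x : ℤ → ℤ) (i : ℤ) : ℤ :=
  sSup {s : ℤ | ∃ k : ℤ, 1 ≤ k ∧ idx k = i ∧ sigmaP a1 a2 x k = s}

noncomputable def kmaxP (x : ℤ → ℤ) (i : ℤ) : ℤ :=
  sSup {k : ℤ | 1 ≤ k ∧ idx k = i ∧ sigmaP a1 a2 x k = epsP a1 a2 x i}

noncomputable def kminP (x : ℤ → ℤ) (i : ℤ) : ℤ :=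
  sInf {k : ℤ | 1 ≤ k ∧ idx k = i ∧ sigmaP a1 a2 x k = epsP a1 a2 x i}

/-- `ẽ_i` on `ℤ^{+∞}` (partial). -/
noncomputable def eP (i : ℤ) (x : ℤ → ℤ) : Option (ℤ → ℤ) :=
  if 0 < epsP a1 a2 x i then
    some (Function.update x (kmaxP a1 a2 x i) (x (kmaxP a1 a2 x i) - 1))
  else none

/-- `f̃_i` on `ℤ^{+∞}` (total). -/
noncomputable def fP (i : ℤ) (x : ℤ → ℤ) : ℤ → ℤ :=
  Function.update x (kminP a1 a2 x i) (x (kminP a1 a2 x i) + 1)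

/-- `φ_i` on `ℤ^{−∞}`. -/
noncomputable def phiMf (x : ℤ → ℤ) (i : ℤ) : ℤ :=
  sSup {s : ℤ | ∃ k : ℤ, k ≤ 0 ∧ idx k = i ∧ sigmaM a1 a2 x k = s}

noncomputable def kmaxM (x : ℤ → ℤ) (i : ℤ) : ℤ :=
  sSup {k : ℤ | k ≤ 0 ∧ idx k = i ∧ sigmaM a1 a2 x k = phiMf a1 a2 x i}

noncomputable def kminM (x : ℤ → ℤ) (i : ℤ) : ℤ :=
  sInf {k : ℤ | k ≤ 0 ∧ idx k = i ∧ sigmaM a1 a2 x k = phiMf a1 a2 x i}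

/-- `ẽ_i` on `ℤ^{−∞}` (total). -/
noncomputable def eM (i : ℤ) (x : ℤ → ℤ) : ℤ → ℤ :=
  Function.update x (kmaxM a1 a2 x i) (x (kmaxM a1 a2 x i) - 1)

noncomputable def fPiter (i : ℤ) (n : ℕ) (x : ℤ → ℤ) : ℤ → ℤ := (fP a1 a2 i)^[n] x

noncomputable def eMiter (i : ℤ) (n : ℕ) (x : ℤ → ℤ) : ℤ → ℤ := (eM a1 a2 i)^[n] x

noncomputable def ePiterO (i : ℤ) (n : ℕ) (ox : Option (ℤ → ℤ)) : Option (ℤ → ℤ) :=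
  (fun o => o.bind (eP a1 a2 i))^[n] ox

noncomputable def eZiterO (μ : ℤ × ℤ) (i : ℤ) (n : ℕ) (ox : Option (ℤ → ℤ)) : Option (ℤ → ℤ) :=
  (fun o => o.bind (eZ a1 a2 μ i))^[n] ox

noncomputable def fZiterO (μ : ℤ × ℤ) (i : ℤ) (n : ℕ) (ox : Option (ℤ → ℤ)) : Option (ℤ → ℤ) :=
  (fun o => o.bind (fZ a1 a2 μ i))^[n] ox

noncomputable def suppBoundP (x : ℤ → ℤ) : ℕ := sInf {N : ℕ | ∀ k : ℤ, (N : ℤ) < k → x k = 0}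

noncomputable def suppBoundM (x : ℤ → ℤ) : ℕ := sInf {N : ℕ | ∀ k : ℤ, k < -(N : ℤ) → x k = 0}

/-- `starPChain x n z = f̃_{i_1}^{x_1} ⋯ f̃_{i_n}^{x_n} (z)` on `ℤ^{+∞}`. -/
noncomputable def starPChain (x : ℤ → ℤ) : ℕ → (ℤ → ℤ) → (ℤ → ℤ)
  | 0, z => z
  | n + 1, z => starPChain x n (fPiter a1 a2 (idx ((n : ℤ) + 1)) ((x ((n : ℤ) + 1)).toNat) z)

/-- the `∗`-operation on `X+`: `(x⁺)* = f̃_{i_1}^{x_1} ⋯ f̃_{i_N}^{x_N} (z_∞)`. -/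
noncomputable def starP (x : ℤ → ℤ) : ℤ → ℤ :=
  starPChain a1 a2 x (suppBoundP x) (fun _ => 0)

/-- `starMChain x n z = ẽ_{i_0}^{−x_0} ⋯ ẽ_{i_{-(n-1)}}^{−x_{-(n-1)}} (z)` on `ℤ^{−∞}`. -/
noncomputable def starMChain (x : ℤ → ℤ) : ℕ → (ℤ → ℤ) → (ℤ → ℤ)
  | 0, z => z
  | n + 1, z => starMChain x n (eMiter a1 a2 (idx (-(n : ℤ))) ((-(x (-(n : ℤ)))).toNat) z)

/-- the `∗`-operation on `X−`. -/
noncomputable def starM (x : ℤ → ℤ) : ℤ → ℤ :=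
  starMChain a1 a2 x (suppBoundM x + 1) (fun _ => 0)

/-- combine a `ℤ^{+∞}`- and a `ℤ^{−∞}`-component into an element of `Z_ι(μ)`. -/
def combine (y z : ℤ → ℤ) : ℤ → ℤ := fun k => if 1 ≤ k then y k else z k

/-- the coordinates of `x* = (x⁺)* ⊗ t_μ ⊗ (x⁻)*`. -/
noncomputable def xstarFun (x : ℤ → ℤ) : ℤ → ℤ :=
  combine (starP a1 a2 (posPart x)) (starM a1 a2 (negPart x))

/-- the weight `μ = −λ − wt(x⁺) − wt(x⁻)` of `x*`. -/
noncomputable def mustar (lam : ℤ × ℤ) (x : ℤ → ℤ) : ℤ × ℤ :=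
  -lam - wtOf a1 a2 (posPart x) - wtOf a1 a2 (negPart x)

/-- `fPnegChain g n z = f̃_{i_{-(n-1)}}^{g(-(n-1))} ⋯ f̃_{i_{-1}}^{g(-1)} f̃_{i_0}^{g 0} (z)`. -/
noncomputable def fPnegChain (g : ℤ → ℕ) : ℕ → (ℤ → ℤ) → (ℤ → ℤ)
  | 0, z => z
  | n + 1, z => fPiter a1 a2 (idx (-(n : ℤ))) (g (-(n : ℤ))) (fPnegChain g n z)

/-- `eMposChain g n z = ẽ_{i_n}^{g n} ⋯ ẽ_{i_2}^{g 2} ẽ_{i_1}^{g 1} (z)`. -/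
noncomputable def eMposChain (g : ℤ → ℕ) : ℕ → (ℤ → ℤ) → (ℤ → ℤ)
  | 0, z => z
  | n + 1, z => eMiter a1 a2 (idx ((n : ℤ) + 1)) (g ((n : ℤ) + 1)) (eMposChain g n z)

/-- `ePposChainO g n z = ẽ_{i_n}^{g n} ⋯ ẽ_{i_2}^{g 2} ẽ_{i_1}^{g 1} (z)` on `ℤ^{+∞}`. -/
noncomputable def ePposChainO (g : ℤ → ℕ) : ℕ → Option (ℤ → ℤ) → Option (ℤ → ℤ)
  | 0, z => z
  | n + 1, z => ePiterO a1 a2 (idx ((n : ℤ) + 1)) (g ((n : ℤ) + 1)) (ePposChainO g n z)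

/-- the Weyl group action `S_i` on `Z_ι(μ) ∪ {0}`. -/
noncomputable def SiO (μ : ℤ × ℤ) (i : ℤ) (ob : Option (ℤ → ℤ)) : Option (ℤ → ℤ) :=
  ob.bind fun b =>
    if 0 ≤ pairW (wtZ a1 a2 μ b) i then
      fZiterO a1 a2 μ i (pairW (wtZ a1 a2 μ b) i).toNat (some b)
    else eZiterO a1 a2 μ i (-(pairW (wtZ a1 a2 μ b) i)).toNat (some b)

/-- `SwPos μ n = S_{i_n} ⋯ S_{i_2} S_{i_1}`. -/
noncomputable def SwPos (μ : ℤ × ℤ) : ℕ → Option (ℤ → ℤ) → Option (ℤ → ℤ)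
  | 0, b => b
  | n + 1, b => SiO a1 a2 μ (idx ((n : ℤ) + 1)) (SwPos μ n b)

/-- `SwNeg μ n = S_{i_{-(n-1)}} ⋯ S_{i_{-1}} S_{i_0}`. -/
noncomputable def SwNeg (μ : ℤ × ℤ) : ℕ → Option (ℤ → ℤ) → Option (ℤ → ℤ)
  | 0, b => b
  | n + 1, b => SiO a1 a2 μ (idx (-(n : ℤ))) (SwNeg μ n b)

/-- `S_{w_k}`. -/
noncomputable def Swk (μ : ℤ × ℤ) (k : ℤ) (b : Option (ℤ → ℤ)) : Option (ℤ → ℤ) :=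
  if 0 ≤ k then SwPos a1 a2 μ k.toNat b else SwNeg a1 a2 μ (-k).toNat b

/-- `b ∈ Z_ι(μ)` is extremal. -/
noncomputable def Extremal (μ : ℤ × ℤ) (b : ℤ → ℤ) : Prop :=
  ∀ js : List ℤ, (∀ j ∈ js, IsI j) →
    ∃ b', js.foldr (SiO a1 a2 μ) (some b) = some b' ∧
      ∀ i : ℤ, IsI i →
        (0 ≤ pairW (wtZ a1 a2 μ b') i → eZ a1 a2 μ i b' = none) ∧
        (pairW (wtZ a1 a2 μ b') i ≤ 0 → fZ a1 a2 μ i b' = none)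

/-- `φ(x) ≥ 0` for all `φ ∈ Ξ_ι[λ]`. -/
noncomputable def SigmaCond (x : ℤ → ℤ) : Prop :=
  (0 ≤ gammaR a1 a2 0 * (pseq a1 a2 k1 k2 0 : ℝ) + gammaR a1 a2 0 * (x 0 : ℝ) - (x 1 : ℝ)) ∧
  (0 ≤ gammaR a1 a2 1 * (pseq a1 a2 k1 k2 1 : ℝ) + (x 0 : ℝ) - gammaR a1 a2 1 * (x 1 : ℝ)) ∧
  (∀ k : ℤ, 1 ≤ k → 0 ≤ (pseq a1 a2 k1 k2 k : ℝ) - (x k : ℝ)) ∧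
  (∀ k : ℤ, 1 ≤ k → 0 ≤ gammaR a1 a2 k * (x k : ℝ) - (x (k + 1) : ℝ)) ∧
  (∀ k : ℤ, 1 ≤ k → 0 ≤ gammaR a1 a2 (k + 1) * (pseq a1 a2 k1 k2 (k + 1) : ℝ) -
      (pseq a1 a2 k1 k2 k : ℝ) + (x k : ℝ) - gammaR a1 a2 (k + 1) * (x (k + 1) : ℝ)) ∧
  (∀ k : ℤ, k ≤ 0 → 0 ≤ (pseq a1 a2 k1 k2 k : ℝ) + (x k : ℝ)) ∧
  (∀ k : ℤ, k ≤ 0 → 0 ≤ (x (k - 1) : ℝ) - gammaR a1 a2 k * (x k : ℝ)) ∧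
  (∀ k : ℤ, k ≤ 0 → 0 ≤ gammaR a1 a2 (k - 1) * (pseq a1 a2 k1 k2 (k - 1) : ℝ) -
      (pseq a1 a2 k1 k2 k : ℝ) + gammaR a1 a2 (k - 1) * (x (k - 1) : ℝ) - (x k : ℝ))

/-- membership in `Σ_ι[λ]`. -/
noncomputable def SigmaMem (x : ℤ → ℤ) : Prop :=
  ZMem x ∧ SigmaCond a1 a2 k1 k2 x

/-- membership in `Σ'_ι[λ]`. -/
noncomputable def SigmaPrimeMem (x : ℤ → ℤ) : Prop :=
  SigmaMem a1 a2 k1 k2 x ∧ (∀ k : ℤ, k ≤ 0 → x k = 0) ∧ XPlusMem a1 a2 (posPart x)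

/-- evaluation of an affine function `φ = (c, (φ_l)_l)` at `x`. -/
noncomputable def evalAff (φ : ℝ × (ℤ → ℝ)) (x : ℤ → ℤ) : ℝ :=
  φ.1 + ∑ᶠ l : ℤ, φ.2 l * (x l : ℝ)

/-- `a_{i_k}`. -/
def aIdx (k : ℤ) : ℤ := if k % 2 = 1 then a1 else a2

/-- the affine function `b̄_k`. -/
noncomputable def bbar (lam : ℤ × ℤ) (k : ℤ) : ℝ × (ℤ → ℝ) :=
  ((if k = -1 ∨ k = 0 then -(pairW lam (idx k) : ℝ) else 0),
    fun l => (if l = k then (1 : ℝ) else 0) + (if l = k + 1 then -(aIdx a1 a2 k : ℝ) else 0) +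
      (if l = k + 2 then (1 : ℝ) else 0))

/-- the operator `S̄_k` on affine functions. -/
noncomputable def SbarOp (lam : ℤ × ℤ) (k : ℤ) (φ : ℝ × (ℤ → ℝ)) : ℝ × (ℤ → ℝ) :=
  let b := if 0 ≤ φ.2 k then bbar a1 a2 lam (k + 2) else bbar a1 a2 lam (k - 2)
  (φ.1 - φ.2 k * b.1, fun l => φ.2 l - φ.2 k * b.2 l)

end HypCrystal

namespace HypCrystal

variable {a1 a2 N k j i : ℤ} {x y : ℤ → ℤ}

/-- All coordinates at positions above `N` vanish. -/
def VanishAbove (N : ℤ) (y : ℤ → ℤ) : Prop := ∀ k, N < k → y k = 0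

/-- `Σ_{j ≥ k} ⟨α_{i_j}, α_i^∨⟩ y_j`. -/
noncomputable def tailPair (a1 a2 k i : ℤ) (y : ℤ → ℤ) : ℤ :=
  ∑ᶠ j : ℤ, if k ≤ j then pairJI a1 a2 j i * y j else 0

/-- `ε_i` of the truncation of `y` to the positions `≥ k`. -/
noncomputable def tailEps (a1 a2 k i : ℤ) (y : ℤ → ℤ) : ℤ :=
  sSup {s : ℤ | ∃ j : ℤ, k ≤ j ∧ idx j = i ∧ sigmaP a1 a2 y j = s}

/-- `ẽ_i^{max}` on `ℤ^{+∞}` in closed form. -/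
noncomputable def eMax (a1 a2 i : ℤ) (y : ℤ → ℤ) : ℤ → ℤ := fun j =>
  if 1 ≤ j then y j - (tailEps a1 a2 j i y - tailEps a1 a2 (j + 1) i y) else y j

/-- `ẽ_{i_n}^{max} ⋯ ẽ_{i_1}^{max} y`. -/
noncomputable def eMaxChain (a1 a2 : ℤ) (y : ℤ → ℤ) : ℕ → ℤ → ℤ
  | 0 => y
  | n + 1 => eMax a1 a2 (idx ((n : ℤ) + 1)) (eMaxChain a1 a2 y n)

/-- The string of the truncation of `y` to the positions `≥ k`,
in the direction `(i_1, i_2, …)`. -/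
noncomputable def tailString (a1 a2 k : ℤ) (y : ℤ → ℤ) : ℤ → ℤ := fun j =>
  if 1 ≤ j then tailEps a1 a2 k (idx j) (eMaxChain a1 a2 y (j - 1).toNat) else 0

lemma isI_idx (k : ℤ) : IsI (idx k) := by
  unfold IsI idx; split_ifs <;> simp

lemma idx_add_two (k : ℤ) : idx (k + 2) = idx k := by
  unfold idx; simp

lemma idx_add_one_ne (k : ℤ) : idx (k + 1) ≠ idx k := by
  unfold idx
  split_ifs <;> omega

lemma pairJI_self (k : ℤ) : pairJI a1 a2 k (idx k) = 2 := by
  simp [pairJI]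

lemma pairJI_succ (k : ℤ) : pairJI a1 a2 (k + 1) (idx k) = -aIdx a1 a2 k := by
  rw [pairJI, if_neg (idx_add_one_ne k)]
  unfold idx aIdx
  split_ifs <;> simp_all

lemma pairJI_congr (h : idx j = idx k) (i : ℤ) : pairJI a1 a2 j i = pairJI a1 a2 k i := by
  simp [pairJI, h]

lemma pairJK_eq (j k : ℤ) : pairJK a1 a2 j k = pairJI a1 a2 j (idx k) := by
  unfold pairJK pairJI idx
  split_ifs <;> first | rfl | omega

lemma exists_idx_eq (hi : IsI i) (k : ℤ) : ∃ j, k ≤ j ∧ idx j = i := by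
  by_cases h : idx k = i
  · exact ⟨k, le_rfl, h⟩
  · refine ⟨k + 1, by omega, ?_⟩
    have h1 := idx_add_one_ne k
    rcases hi with rfl | rfl <;> rcases isI_idx k with h2 | h2 <;>
      rcases isI_idx (k + 1) with h3 | h3 <;> simp_all

lemma downward_induction {P : ℤ → Prop} (N : ℤ) (h0 : ∀ k, N < k → P k)
    (hs : ∀ k, P (k + 1) → P k) (k : ℤ) : P k := by
  have key : ∀ n : ℕ, ∀ k, N < k + n → P k := by
    intro n
    induction n with
    | zero => intro k hk; exact h0 k (by simpa using hk)
    | succ n ih => intro k hk; exact hs k (ih (k + 1) (by push_cast at hk ⊢; omega))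
  exact key (N + 1 - k).toNat k (by omega)

lemma VanishAbove.mono {M : ℤ} (h : VanishAbove N y) (hM : N ≤ M) : VanishAbove M y :=
  fun k hk => h k (by omega)

lemma tailPair_step (h : VanishAbove N y) (k i : ℤ) :
    tailPair a1 a2 k i y = pairJI a1 a2 k i * y k + tailPair a1 a2 (k + 1) i y := by
  unfold tailPair
  have h1 : (fun j : ℤ => if k ≤ j then pairJI a1 a2 j i * y j else 0) =
      fun j => (if j = k then pairJI a1 a2 j i * y j else 0) +
        (if k + 1 ≤ j then pairJI a1 a2 j i * y j else 0) := by
    funext j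
    split_ifs <;> omega
  rw [h1, finsum_add_distrib]
  · congr 1
    rw [finsum_eq_single _ k (fun j hj => by simp [hj])]
    simp
  · apply (Set.finite_singleton k).subset
    intro j hj
    by_contra hne
    simp only [Set.mem_singleton_iff] at hne
    simp [hne] at hj
  · apply (Set.finite_Icc (k + 1) N).subset
    intro j hj
    by_contra hne
    apply hj
    show (if k + 1 ≤ j then pairJI a1 a2 j i * y j else 0) = 0
    split_ifs with hkj
    · rw [h j (by simp only [Set.mem_Icc] at hne; omega), mul_zero]
    · rfl

lemma tailPair_eq_zero (h : VanishAbove N y) (hk : N < k) (i : ℤ) :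
    tailPair a1 a2 k i y = 0 := by
  unfold tailPair
  refine finsum_eq_zero_of_forall_eq_zero fun j => ?_
  split_ifs with hkj
  · rw [h j (by omega), mul_zero]
  · rfl

lemma sigmaP_eq (y : ℤ → ℤ) (k : ℤ) :
    sigmaP a1 a2 y k = y k + tailPair a1 a2 (k + 1) (idx k) y := by
  unfold sigmaP tailPair
  simp only [pairJK_eq, Int.add_one_le_iff]

lemma sigmaP_eq_zero (h : VanishAbove N y) (hk : N < k) : sigmaP a1 a2 y k = 0 := by
  rw [sigmaP_eq, h k hk, tailPair_eq_zero h (by omega), add_zero]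

lemma sigmaP_eq_sub (h : VanishAbove N y) (k : ℤ) :
    sigmaP a1 a2 y k = tailPair a1 a2 k (idx k) y - y k := by
  rw [sigmaP_eq, tailPair_step h k, pairJI_self]; ring

lemma tailPair_succ (h : VanishAbove N y) (k : ℤ) :
    tailPair a1 a2 (k + 1) (idx k) y =
      -aIdx a1 a2 k * y (k + 1) + y (k + 2) + sigmaP a1 a2 y (k + 2) := by
  rw [tailPair_step h (k + 1), pairJI_succ, sigmaP_eq_sub h (k + 2), idx_add_two,
    show k + 1 + 1 = k + 2 by ring]
  ring

lemma bddAbove_tailEps (h : VanishAbove N y) (k i : ℤ) :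
    BddAbove {s : ℤ | ∃ j : ℤ, k ≤ j ∧ idx j = i ∧ sigmaP a1 a2 y j = s} := by
  apply Set.Finite.bddAbove
  apply (((Set.finite_Icc k N).image (sigmaP a1 a2 y)).union (Set.finite_singleton 0)).subset
  rintro s ⟨j, hkj, -, rfl⟩
  by_cases hj : j ≤ N
  · exact Or.inl ⟨j, ⟨hkj, hj⟩, rfl⟩
  · exact Or.inr (sigmaP_eq_zero h (by omega))

lemma le_tailEps (h : VanishAbove N y) (hkj : k ≤ j) (hj : idx j = i) :
    sigmaP a1 a2 y j ≤ tailEps a1 a2 k i y :=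
  le_csSup (bddAbove_tailEps h k i) ⟨j, hkj, hj, rfl⟩

lemma exists_eq_tailEps (h : VanishAbove N y) (hi : IsI i) (k : ℤ) :
    ∃ j, k ≤ j ∧ idx j = i ∧ sigmaP a1 a2 y j = tailEps a1 a2 k i y := by
  obtain ⟨j, hkj, hj⟩ := exists_idx_eq hi k
  have hne : {s : ℤ | ∃ j : ℤ, k ≤ j ∧ idx j = i ∧ sigmaP a1 a2 y j = s}.Nonempty :=
    ⟨_, j, hkj, hj, rfl⟩
  exact Int.csSup_mem hne (bddAbove_tailEps h k i)

lemma tailEps_nonneg (h : VanishAbove N y) (hi : IsI i) (k : ℤ) : 0 ≤ tailEps a1 a2 k i y := by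
  obtain ⟨j, hkj, hj⟩ := exists_idx_eq hi (max k (N + 1))
  rw [← sigmaP_eq_zero (a1 := a1) (a2 := a2) h (k := j) (by omega)]
  exact le_tailEps h (by omega) hj

lemma tailEps_eq_zero (h : VanishAbove N y) (hi : IsI i) (hk : N < k) :
    tailEps a1 a2 k i y = 0 := by
  obtain ⟨j, hkj, hj, hs⟩ := exists_eq_tailEps (a1 := a1) (a2 := a2) h hi k
  rw [← hs, sigmaP_eq_zero h (by omega)]

lemma tailEps_step_self (h : VanishAbove N y) (hk : idx k = i) :
    tailEps a1 a2 k i y = max (sigmaP a1 a2 y k) (tailEps a1 a2 (k + 1) i y) := by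
  have hi : IsI i := hk ▸ isI_idx k
  apply le_antisymm
  · obtain ⟨j, hkj, hj, hs⟩ := exists_eq_tailEps (a1 := a1) (a2 := a2) h hi k
    rw [← hs]
    rcases hkj.eq_or_lt with rfl | hlt
    · exact le_max_left _ _
    · exact le_max_of_le_right (le_tailEps h (by omega) hj)
  · apply max_le (le_tailEps h le_rfl hk)
    obtain ⟨j, hkj, hj, hs⟩ := exists_eq_tailEps (a1 := a1) (a2 := a2) h hi (k + 1)
    rw [← hs]
    exact le_tailEps h (by omega) hj

lemma tailEps_step_ne (hk : idx k ≠ i) :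
    tailEps a1 a2 k i y = tailEps a1 a2 (k + 1) i y := by
  unfold tailEps
  congr 1
  ext s
  constructor
  · rintro ⟨j, hkj, hj, hs⟩
    refine ⟨j, ?_, hj, hs⟩
    rcases hkj.eq_or_lt with rfl | hlt
    · exact absurd hj hk
    · omega
  · rintro ⟨j, hkj, hj, hs⟩
    exact ⟨j, by omega, hj, hs⟩

lemma tailEps_succ_le (h : VanishAbove N y) (k i : ℤ) :
    tailEps a1 a2 (k + 1) i y ≤ tailEps a1 a2 k i y := by
  by_cases hk : idx k = i
  · rw [tailEps_step_self h hk]; exact le_max_right _ _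
  · rw [tailEps_step_ne hk]

/-- The recursion in `k` determines `tailEps`. -/
lemma tailEps_unique (h : VanishAbove N y) (hi : IsI i) {M : ℤ} {G : ℤ → ℤ}
    (hG0 : ∀ k, M < k → G k = 0)
    (hG : ∀ k, 1 ≤ k → G k = if idx k = i then max (sigmaP a1 a2 y k) (G (k + 1)) else G (k + 1))
    (k : ℤ) : 1 ≤ k → tailEps a1 a2 k i y = G k := by
  refine downward_induction (P := fun k => 1 ≤ k → tailEps a1 a2 k i y = G k) (max M N) ?_ ?_ k
  · intro k hk _
    rw [hG0 k (by omega), tailEps_eq_zero h hi (by omega)]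
  · intro k ih hk
    rw [hG k hk]
    split_ifs with hki
    · rw [tailEps_step_self h hki, ih (by omega)]
    · rw [tailEps_step_ne hki, ih (by omega)]

/-- Effect on `tailPair` of moving `D_k - D_{k+1}` into the positions of one color. -/
lemma tailPair_add {r D : ℤ → ℤ} (h : VanishAbove N y) (hr : VanishAbove N r) (m : ℤ)
    (hD0 : ∀ k, N < k → D k = 0) (hD : ∀ k, 1 ≤ k → idx k ≠ idx m → D k = D (k + 1))
    (hrD : ∀ k, 1 ≤ k → r k = y k + D k - D (k + 1)) (i k : ℤ) :
    1 ≤ k → tailPair a1 a2 k i r = tailPair a1 a2 k i y + pairJI a1 a2 m i * D k := by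
  refine downward_induction (P := fun k => 1 ≤ k → tailPair a1 a2 k i r =
    tailPair a1 a2 k i y + pairJI a1 a2 m i * D k) N ?_ ?_ k
  · intro k hk _
    rw [tailPair_eq_zero h hk, tailPair_eq_zero hr hk, hD0 k hk]; ring
  · intro k ih hk
    rw [tailPair_step h k, tailPair_step hr k, ih (by omega), hrD k hk]
    by_cases hkm : idx k = idx m
    · rw [pairJI_congr hkm]; ring
    · rw [hD k hk hkm]; ring

lemma eMax_apply (hj : 1 ≤ j) :
    eMax a1 a2 i y j = y j - (tailEps a1 a2 j i y - tailEps a1 a2 (j + 1) i y) :=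
  if_pos hj

lemma eMax_of_ne (hj : idx j ≠ i) : eMax a1 a2 i y j = y j := by
  unfold eMax
  rw [tailEps_step_ne hj]
  simp

lemma VanishAbove.eMax (h : VanishAbove N y) (hi : IsI i) : VanishAbove N (eMax a1 a2 i y) := by
  intro k hk
  unfold HypCrystal.eMax
  rw [tailEps_eq_zero h hi hk, tailEps_eq_zero h hi (by omega), h k hk]
  simp

lemma tailPair_eMax (h : VanishAbove N y) (m i : ℤ) (hk : 1 ≤ k) :
    tailPair a1 a2 k i (eMax a1 a2 (idx m) y) =
      tailPair a1 a2 k i y - pairJI a1 a2 m i * tailEps a1 a2 k (idx m) y := by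
  rw [tailPair_add (D := fun k => -tailEps a1 a2 k (idx m) y) h (h.eMax (isI_idx m)) m
    (fun k hk => by simp [tailEps_eq_zero h (isI_idx m) hk])
    (fun k _ hkm => by simp [tailEps_step_ne hkm])
    (fun k hk => by rw [eMax_apply hk]; ring) i k hk]
  ring

lemma sigmaP_eMax (h : VanishAbove N y) (hj : 1 ≤ j) :
    sigmaP a1 a2 (eMax a1 a2 (idx j) y) j =
      sigmaP a1 a2 y j - tailEps a1 a2 j (idx j) y - tailEps a1 a2 (j + 1) (idx j) y := by
  rw [sigmaP_eq, sigmaP_eq, tailPair_eMax h j _ (by omega), eMax_apply hj, pairJI_self]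
  ring

/-- `G_j` is the number of the first `n` operators `f̃_i` applied to `y` that act on positions
`≥ j`, for `y` with `ε_i(y) = 0`. -/
structure IsSpread (a1 a2 i n : ℤ) (y G : ℤ → ℤ) : Prop where
  one : G 1 = n
  step : ∀ j, 1 ≤ j → G (j + 1) = if idx j = i then min (G j) (-sigmaP a1 a2 y j) else G j

/-- The sequence obtained from `y` by distributing the increments of `G`. -/
def addSpread (y G : ℤ → ℤ) : ℤ → ℤ := fun j => if 1 ≤ j then y j + G j - G (j + 1) else y j

/-- `ε_i(y) ≤ 0` on `ℤ^{+∞}`. -/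
def EpsNonpos (a1 a2 i : ℤ) (y : ℤ → ℤ) : Prop := ∀ j, 1 ≤ j → idx j = i → sigmaP a1 a2 y j ≤ 0

section Spread

variable {n : ℤ} {G : ℤ → ℤ}

lemma IsSpread.nonneg (hG : IsSpread a1 a2 i n y G) (hn : 0 ≤ n) (hε : EpsNonpos a1 a2 i y)
    (hj : 1 ≤ j) : 0 ≤ G j := by
  induction j, hj using Int.leInduction with
  | base => rw [hG.one]; exact hn
  | succ j hj ih =>
    rw [hG.step j hj]
    split_ifs with hji
    · have := hε j hj hji
      exact le_min ih (by omega)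
    · exact ih

lemma IsSpread.succ_le (hG : IsSpread a1 a2 i n y G) (hj : 1 ≤ j) : G (j + 1) ≤ G j := by
  rw [hG.step j hj]
  split_ifs
  · exact min_le_left _ _
  · exact le_rfl

lemma IsSpread.le (hG : IsSpread a1 a2 i n y G) (hj : 1 ≤ j) : G j ≤ n := by
  induction j, hj using Int.leInduction with
  | base => exact hG.one.le
  | succ j hj ih => exact (hG.succ_le hj).trans ih

lemma IsSpread.eq_zero (hG : IsSpread a1 a2 i n y G) (hn : 0 ≤ n) (hε : EpsNonpos a1 a2 i y)
    (h : VanishAbove N y) (hi : IsI i) (hj : max N 0 + 2 < j) : G j = 0 := by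
  apply le_antisymm _ (hG.nonneg hn hε (by omega))
  obtain ⟨l, hl, hli, hlj⟩ : ∃ l, max N 0 < l ∧ idx l = i ∧ (l + 1 = j ∨ l + 2 = j) := by
    by_cases h1 : idx (j - 1) = i
    · exact ⟨j - 1, by omega, h1, by omega⟩
    · refine ⟨j - 2, by omega, ?_, by omega⟩
      have h2 := idx_add_one_ne (j - 2)
      rw [show j - 2 + 1 = j - 1 by ring] at h2
      rcases hi with rfl | rfl <;> rcases isI_idx (j - 1) with h3 | h3 <;>
        rcases isI_idx (j - 2) with h4 | h4 <;> simp_all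
  have h1 : G (l + 1) ≤ 0 := by
    rw [hG.step l (by omega), if_pos hli, sigmaP_eq_zero h (by omega)]
    simp
  rcases hlj with rfl | rfl
  · exact h1
  · have := hG.succ_le (j := l + 1) (by omega)
    rw [show l + 1 + 1 = l + 2 by ring] at this
    omega

lemma IsSpread.vanishAbove_addSpread (hG : IsSpread a1 a2 i n y G) (hn : 0 ≤ n)
    (hε : EpsNonpos a1 a2 i y) (h : VanishAbove N y) (hi : IsI i) :
    VanishAbove (max N 0 + 2) (addSpread y G) := by
  intro k hk
  rw [addSpread, if_pos (by omega), hG.eq_zero hn hε h hi hk,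
    hG.eq_zero hn hε h hi (by omega), h k (by omega)]
  simp

lemma IsSpread.sigmaP_addSpread (hG : IsSpread a1 a2 i n y G) (hn : 0 ≤ n)
    (hε : EpsNonpos a1 a2 i y) (h : VanishAbove N y) (hj : 1 ≤ j) (hji : idx j = i) :
    sigmaP a1 a2 (addSpread y G) j = sigmaP a1 a2 y j + G j + G (j + 1) := by
  have hi : IsI i := hji ▸ isI_idx j
  rw [sigmaP_eq, sigmaP_eq, tailPair_add (D := G) (h.mono (M := max N 0 + 2) (by omega))
    (hG.vanishAbove_addSpread hn hε h hi) j (fun k hk => hG.eq_zero hn hε h hi hk)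
    (fun k hk hkj => by rw [hG.step k hk, if_neg (by rwa [← hji])])
    (fun k hk => if_pos hk) (idx j) (j + 1) (by omega), pairJI_self, addSpread, if_pos hj]
  ring

lemma IsSpread.tailEps_addSpread (hG : IsSpread a1 a2 i n y G) (hn : 0 ≤ n)
    (hε : EpsNonpos a1 a2 i y) (h : VanishAbove N y) (hi : IsI i) (hj : 1 ≤ j) :
    tailEps a1 a2 j i (addSpread y G) = G j := by
  refine tailEps_unique (hG.vanishAbove_addSpread hn hε h hi) hi
    (fun k hk => hG.eq_zero hn hε h hi hk) (fun k hk => ?_) j hj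
  have h1 := hG.step k hk
  split_ifs at h1 ⊢ with hki
  · rw [hG.sigmaP_addSpread hn hε h hk hki]
    omega
  · exact h1.symm

lemma IsSpread.eMax_addSpread (hG : IsSpread a1 a2 i n y G) (hn : 0 ≤ n)
    (hε : EpsNonpos a1 a2 i y) (h : VanishAbove N y) (hi : IsI i) :
    eMax a1 a2 i (addSpread y G) = y := by
  funext j
  by_cases hj : 1 ≤ j
  · rw [eMax_apply hj, hG.tailEps_addSpread hn hε h hi hj,
      hG.tailEps_addSpread hn hε h hi (by omega), addSpread, if_pos hj]
    ring
  · rw [eMax, if_neg hj, addSpread, if_neg hj]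

lemma kminP_spec (h : VanishAbove N y) (hi : IsI i) :
    1 ≤ kminP a1 a2 y i ∧ idx (kminP a1 a2 y i) = i ∧
      sigmaP a1 a2 y (kminP a1 a2 y i) = tailEps a1 a2 1 i y := by
  have hne : {k : ℤ | 1 ≤ k ∧ idx k = i ∧ sigmaP a1 a2 y k = epsP a1 a2 y i}.Nonempty :=
    exists_eq_tailEps h hi 1
  exact Int.csInf_mem hne ⟨1, fun k hk => hk.1⟩

lemma kminP_le (hj : 1 ≤ j) (hji : idx j = i) (hs : sigmaP a1 a2 y j = tailEps a1 a2 1 i y) :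
    kminP a1 a2 y i ≤ j :=
  csInf_le ⟨1, fun _ hk => hk.1⟩ ⟨hj, hji, hs⟩

lemma fPiter_succ (i : ℤ) (m : ℕ) (y : ℤ → ℤ) :
    fPiter a1 a2 i (m + 1) y = fP a1 a2 i (fPiter a1 a2 i m y) :=
  Function.iterate_succ_apply' _ _ _

lemma IsSpread.fPiter_eq (hε : EpsNonpos a1 a2 i y) (h : VanishAbove N y) (hi : IsI i) (m : ℕ) :
    ∀ {G : ℤ → ℤ}, IsSpread a1 a2 i m y G → fPiter a1 a2 i m y = addSpread y G := by
  induction m with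
  | zero =>
    intro G hG
    have h0 : ∀ j, 1 ≤ j → G j = 0 := fun j hj =>
      le_antisymm (hG.le hj) (hG.nonneg (by simp) hε hj)
    funext j
    by_cases hj : 1 ≤ j
    · rw [addSpread, if_pos hj, h0 j hj, h0 (j + 1) (by omega)]
      simp [fPiter]
    · rw [addSpread, if_neg hj]
      simp [fPiter]
  | succ m ih =>
    intro G hG
    have hG' : IsSpread a1 a2 i m y (fun j => min (m : ℤ) (G j)) := by
      constructor
      · rw [hG.one]; push_cast; omega
      · intro j hj
        have := hG.step j hj
        split_ifs at this ⊢ <;> omega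
    have hm : (0 : ℤ) ≤ m := by positivity
    have hle : ∀ j, 1 ≤ j → G j ≤ m + 1 := fun j hj => by simpa using hG.le hj
    rw [fPiter_succ, ih hG']
    set r := addSpread y (fun j => min (m : ℤ) (G j)) with hr
    have hv : VanishAbove (max N 0 + 2) r := hG'.vanishAbove_addSpread hm hε h hi
    have hE : tailEps a1 a2 1 i r = m := by
      rw [hG'.tailEps_addSpread hm hε h hi le_rfl, hG.one]; push_cast; omega
    obtain ⟨hk1, hki, hkσ⟩ := kminP_spec (a1 := a1) (a2 := a2) hv hi
    have hmin : ∀ j, 1 ≤ j → idx j = i → sigmaP a1 a2 r j = m → kminP a1 a2 r i ≤ j :=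
      fun j hj hji hs => kminP_le hj hji (by rw [hs, hE])
    rw [fP]
    generalize kminP a1 a2 r i = k at *
    rw [hE] at hkσ
    have hbelow : ∀ j, 1 ≤ j → j ≤ k → G j = m + 1 := by
      intro j hj
      induction j, hj using Int.leInduction with
      | base => intro _; rw [hG.one]; push_cast; rfl
      | succ j hj ihj =>
        intro hjk
        have h1 := ihj (by omega)
        have h2 := hG.step j hj
        split_ifs at h2 with hji
        · have h3 : sigmaP a1 a2 r j ≠ m := fun hs => by
            have := hmin j hj hji hs
            omega
          rw [hr, hG'.sigmaP_addSpread hm hε h hj hji] at h3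
          omega
        · rw [h2, h1]
    have habove : ∀ j, k + 1 ≤ j → G j ≤ m := by
      intro j hj
      induction j, hj using Int.leInduction with
      | base =>
        have h2 := hG.step k hk1
        rw [if_pos hki] at h2
        rw [hr, hG'.sigmaP_addSpread hm hε h hk1 hki] at hkσ
        have := hle (k + 1) (by omega)
        have := hbelow k hk1 le_rfl
        omega
      | succ j hj ihj => exact (hG.succ_le (by omega)).trans ihj
    funext j
    by_cases hj : 1 ≤ j
    · rw [Function.update_apply, addSpread, if_pos hj]
      split_ifs with hjk
      · subst hjk
        have := hbelow j hj le_rfl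
        have := habove (j + 1) le_rfl
        rw [hr, addSpread, if_pos hj]
        omega
      · rw [hr, addSpread, if_pos hj]
        rcases lt_or_gt_of_ne hjk with hlt | hgt
        · have := hbelow j hj (by omega)
          have := hbelow (j + 1) (by omega) (by omega)
          omega
        · have := habove j (by omega)
          have := habove (j + 1) (by omega)
          omega
    · rw [Function.update_apply, if_neg (by omega), hr, addSpread, addSpread, if_neg hj, if_neg hj]

end Spread

lemma IsSpread.exists (a1 a2 i n : ℤ) (y : ℤ → ℤ) : ∃ G, IsSpread a1 a2 i n y G := by
  let g : ℕ → ℤ := fun m => Nat.rec n (fun l v =>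
    if idx ((l : ℤ) + 1) = i then min v (-sigmaP a1 a2 y ((l : ℤ) + 1)) else v) m
  refine ⟨fun j => g (j - 1).toNat, rfl, fun j hj => ?_⟩
  obtain ⟨l, rfl⟩ : ∃ l : ℕ, j = (l : ℤ) + 1 := ⟨(j - 1).toNat, by omega⟩
  have h1 : ((l : ℤ) + 1 + 1 - 1).toNat = l + 1 := by omega
  have h2 : ((l : ℤ) + 1 - 1).toNat = l := by omega
  simp only [h1, h2]
  rfl

lemma eMax_fPiter (hε : EpsNonpos a1 a2 i y) (h : VanishAbove N y) (hi : IsI i) (m : ℕ) :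
    eMax a1 a2 i (fPiter a1 a2 i m y) = y := by
  obtain ⟨G, hG⟩ := IsSpread.exists a1 a2 i m y
  rw [IsSpread.fPiter_eq hε h hi m hG, hG.eMax_addSpread (by positivity) hε h hi]

lemma tailEps_fPiter (hε : EpsNonpos a1 a2 i y) (h : VanishAbove N y) (hi : IsI i) (m : ℕ) :
    tailEps a1 a2 1 i (fPiter a1 a2 i m y) = m := by
  obtain ⟨G, hG⟩ := IsSpread.exists a1 a2 i m y
  rw [IsSpread.fPiter_eq hε h hi m hG, hG.tailEps_addSpread (by positivity) hε h hi le_rfl, hG.one]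

lemma epsNonpos_eMax (h : VanishAbove N y) : EpsNonpos a1 a2 i (eMax a1 a2 i y) := by
  rintro j hj rfl
  rw [sigmaP_eMax h hj]
  have h1 := tailEps_step_self (a1 := a1) (a2 := a2) h (k := j) rfl
  have h2 := tailEps_nonneg (a1 := a1) (a2 := a2) h (isI_idx j) (j + 1)
  omega

lemma fPiter_eMax (h : VanishAbove N y) (hi : IsI i) :
    fPiter a1 a2 i (tailEps a1 a2 1 i y).toNat (eMax a1 a2 i y) = y := by
  have hn := tailEps_nonneg (a1 := a1) (a2 := a2) h hi 1
  have hG : IsSpread a1 a2 i (tailEps a1 a2 1 i y).toNat (eMax a1 a2 i y)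
      (fun j => tailEps a1 a2 j i y) := by
    refine ⟨by simp [hn], fun j hj => ?_⟩
    split_ifs with hji
    · subst hji
      rw [sigmaP_eMax h hj]
      have h1 := tailEps_step_self (a1 := a1) (a2 := a2) h (k := j) rfl
      omega
    · exact (tailEps_step_ne hji).symm
  rw [IsSpread.fPiter_eq (epsNonpos_eMax h) (h.eMax hi) hi _ hG]
  funext j
  unfold addSpread eMax
  split_ifs <;> ring

/-- Positivity of `c_j` for `j ≥ 1`. -/
def CPos (a1 a2 : ℤ) : Prop := ∀ j : ℤ, 1 ≤ j → 0 < cseq a1 a2 j.toNat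

lemma cseq_step (hj : 1 ≤ j) :
    cseq a1 a2 (j + 1).toNat =
      aIdx a1 a2 j * cseq a1 a2 j.toNat - cseq a1 a2 (j - 1).toNat := by
  obtain ⟨l, rfl⟩ : ∃ l : ℕ, j = (l : ℤ) + 1 := ⟨(j - 1).toNat, by omega⟩
  have h1 : ((l : ℤ) + 1 + 1).toNat = l + 2 := by omega
  have h2 : ((l : ℤ) + 1).toNat = l + 1 := by omega
  have h3 : ((l : ℤ) + 1 - 1).toNat = l := by omega
  rw [h1, h2, h3, cseq, aIdx]
  congr 2
  split_ifs <;> first | rfl | omega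

lemma CPos.nonneg (hc : CPos a1 a2) (j : ℤ) : 0 ≤ cseq a1 a2 j.toNat := by
  by_cases hj : 1 ≤ j
  · exact (hc j hj).le
  · rw [show j.toNat = 0 by omega]; simp [cseq]

lemma XPlusMem.exists_vanishAbove (hy : XPlusMem a1 a2 y) : ∃ N : ℕ, VanishAbove N y := by
  obtain ⟨⟨-, -, N, hN⟩, -⟩ := hy
  exact ⟨N, hN⟩

lemma XPlusMem.nonneg (hy : XPlusMem a1 a2 y) (k : ℤ) : 0 ≤ y k := hy.1.2.1 k

lemma xPlusMem_zero : XPlusMem a1 a2 (fun _ => 0) :=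
  ⟨⟨fun _ _ => rfl, fun _ => le_rfl, 0, fun _ _ => rfl⟩, fun _ _ => by simp⟩

lemma XPlusMem.eMax (hc : CPos a1 a2) (hy : XPlusMem a1 a2 y) (hi : IsI i) :
    XPlusMem a1 a2 (eMax a1 a2 i y) := by
  obtain ⟨N, h⟩ := hy.exists_vanishAbove
  have hle : ∀ j, HypCrystal.eMax a1 a2 i y j ≤ y j := by
    intro j
    unfold HypCrystal.eMax
    have := tailEps_succ_le (a1 := a1) (a2 := a2) h j i
    split_ifs <;> omega
  have hge : ∀ j, 1 ≤ j → idx j = i →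
      min (y j) (aIdx a1 a2 j * y (j + 1) - y (j + 2)) ≤ HypCrystal.eMax a1 a2 i y j := by
    rintro j hj rfl
    rw [eMax_apply hj, tailEps_step_self h rfl, sigmaP_eq, tailPair_succ h]
    have := le_tailEps (a1 := a1) (a2 := a2) h (k := j + 1) (j := j + 2) (by omega) (idx_add_two j)
    rw [neg_mul]
    omega
  have hineq : ∀ j, 1 ≤ j → 0 ≤ cseq a1 a2 j.toNat * HypCrystal.eMax a1 a2 i y j -
      cseq a1 a2 (j - 1).toNat * HypCrystal.eMax a1 a2 i y (j + 1) := by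
    intro j hj
    have hcj := hc j hj
    have hcj' := hc.nonneg (j - 1)
    have h0 := hy.2 j hj
    by_cases hji : idx j = i
    · rw [eMax_of_ne (j := j + 1) (by rw [← hji]; exact idx_add_one_ne j)]
      have h1 := hge j hj hji
      rcases min_le_iff.1 h1 with h2 | h2
      · nlinarith
      · have h3 := hy.2 (j + 1) (by omega)
        rw [cseq_step hj, show j + 1 - 1 = j by ring, show j + 1 + 1 = j + 2 by ring] at h3
        nlinarith
    · rw [eMax_of_ne hji]
      nlinarith [hle (j + 1)]
  have hnn : ∀ j, 0 ≤ HypCrystal.eMax a1 a2 i y j := by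
    intro j
    by_cases hj : 1 ≤ j
    · refine downward_induction (P := fun j => 1 ≤ j → 0 ≤ HypCrystal.eMax a1 a2 i y j) N
        (fun k hk _ => (h.eMax hi k hk).ge) (fun k ih hk => ?_) j hj
      have h1 := hineq k hk
      have h2 := mul_nonneg (hc.nonneg (k - 1)) (ih (by omega))
      exact nonneg_of_mul_nonneg_right (a := cseq a1 a2 k.toNat) (by linarith) (hc k hk)
    · rw [HypCrystal.eMax, if_neg hj]
      exact hy.nonneg j
  refine ⟨⟨fun k hk => ?_, hnn, N, fun k hk => h.eMax hi k hk⟩, hineq⟩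
  rw [HypCrystal.eMax, if_neg (by omega)]
  exact hy.1.1 k hk

lemma XPlusMem.fP (hc : CPos a1 a2) (hy : XPlusMem a1 a2 y) (hi : IsI i) :
    XPlusMem a1 a2 (fP a1 a2 i y) := by
  obtain ⟨N, h⟩ := hy.exists_vanishAbove
  obtain ⟨hk1, hki, hkσ⟩ := kminP_spec (a1 := a1) (a2 := a2) h hi
  have hmin := fun j => kminP_le (a1 := a1) (a2 := a2) (y := y) (i := i) (j := j)
  unfold HypCrystal.fP
  generalize kminP a1 a2 y i = k at *
  refine ⟨⟨fun j hj => ?_, fun j => ?_, max N k.toNat, fun j hj => ?_⟩, fun j hj => ?_⟩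
  · rw [Function.update_of_ne (by omega)]
    exact hy.1.1 j hj
  · have := hy.nonneg j
    rw [Function.update_apply]
    split_ifs with hjk
    · subst hjk; omega
    · exact this
  · rw [Function.update_of_ne (by omega)]
    exact h j (by omega)
  · have h0 := hy.2 j hj
    have hcj := hc j hj
    by_cases hjk : j = k
    · subst hjk
      rw [Function.update_self, Function.update_of_ne (by omega)]
      linarith
    · rw [Function.update_of_ne hjk]
      by_cases hjk' : j + 1 = k
      · subst hjk'
        rw [Function.update_self]
        by_cases hj1 : j = 1
        · subst hj1
          simpa [cseq] using hy.nonneg 1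
        · obtain ⟨l, rfl⟩ : ∃ l, j = l + 1 := ⟨j - 1, by ring⟩
          have e : l + 1 + 1 = l + 2 := by ring
          have hl : 1 ≤ l := by omega
          rw [e] at h0 hki hkσ hmin ⊢
          have hli : idx l = i := by rw [← hki, idx_add_two]
          have hlt : sigmaP a1 a2 y l < sigmaP a1 a2 y (l + 2) := by
            rw [hkσ]
            refine lt_of_le_of_ne (le_tailEps h hl hli) fun hs => ?_
            have := hmin l hl hli hs
            omega
          rw [sigmaP_eq, tailPair_succ h] at hlt
          have h3 := hy.2 l hl
          have hcl := hc l hl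
          rw [show l + 1 - 1 = l by ring, cseq_step hl] at h0 ⊢
          nlinarith
      · rwa [Function.update_of_ne hjk']

lemma XPlusMem.fPiter (hc : CPos a1 a2) (hy : XPlusMem a1 a2 y) (hi : IsI i) (m : ℕ) :
    XPlusMem a1 a2 (fPiter a1 a2 i m y) := by
  induction m with
  | zero => exact hy
  | succ m ih => rw [fPiter_succ]; exact ih.fP hc hi

lemma XPlusMem.starPChain (hc : CPos a1 a2) (x : ℤ → ℤ) (n : ℕ) :
    ∀ {y : ℤ → ℤ}, XPlusMem a1 a2 y → XPlusMem a1 a2 (starPChain a1 a2 x n y) := by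
  induction n with
  | zero => exact fun hy => hy
  | succ n ih => exact fun hy => ih (hy.fPiter hc (isI_idx _) _)

lemma xPlusMem_starP (hc : CPos a1 a2) (x : ℤ → ℤ) : XPlusMem a1 a2 (starP a1 a2 x) :=
  xPlusMem_zero.starPChain hc x _

lemma XPlusMem.eMaxChain (hc : CPos a1 a2) (hy : XPlusMem a1 a2 y) (n : ℕ) :
    XPlusMem a1 a2 (eMaxChain a1 a2 y n) := by
  induction n with
  | zero => exact hy
  | succ n ih => exact ih.eMax hc (isI_idx _)

lemma tailEps_eq_zero_of_one (h : VanishAbove N y) (hi : IsI i) (h0 : tailEps a1 a2 1 i y = 0)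
    (hk : 1 ≤ k) : tailEps a1 a2 k i y = 0 := by
  apply le_antisymm _ (tailEps_nonneg h hi k)
  obtain ⟨j, hkj, hj, hs⟩ := exists_eq_tailEps (a1 := a1) (a2 := a2) h hi k
  rw [← hs, ← h0]
  exact le_tailEps h (by omega) hj

lemma eMax_eq_self (h : VanishAbove N y) (hi : IsI i) (h0 : tailEps a1 a2 1 i y = 0) :
    eMax a1 a2 i y = y := by
  funext j
  by_cases hj : 1 ≤ j
  · rw [eMax_apply hj, tailEps_eq_zero_of_one h hi h0 hj,
      tailEps_eq_zero_of_one h hi h0 (by omega)]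
    ring
  · rw [eMax, if_neg hj]

lemma eMax_zero (hi : IsI i) : eMax a1 a2 i (fun _ => 0) = fun _ => 0 := by
  have h : VanishAbove 0 (fun _ => 0) := fun _ _ => rfl
  exact eMax_eq_self h hi (tailEps_eq_zero h hi one_pos)

lemma XPlusMem.eq_zero (hy : XPlusMem a1 a2 y) (h0 : ∀ i, IsI i → tailEps a1 a2 1 i y = 0) :
    y = fun _ => 0 := by
  obtain ⟨N, h⟩ := hy.exists_vanishAbove
  have key := downward_induction (P := fun k => 1 ≤ k → ∀ l, k ≤ l → y l = 0) N
    (fun k hk _ l hl => h l (by omega)) (fun k ih hk l hl => by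
      rcases hl.eq_or_lt with rfl | hlt
      · have hv : VanishAbove k y := fun l hl => ih (by omega) l (by omega)
        have h1 := le_tailEps (a1 := a1) (a2 := a2) h hk (rfl : idx k = idx k)
        rw [h0 _ (isI_idx k), sigmaP_eq, tailPair_eq_zero hv (by omega)] at h1
        have := hy.nonneg k
        omega
      · exact ih (by omega) l (by omega))
  funext k
  by_cases hk : 1 ≤ k
  · exact key k hk k le_rfl
  · exact hy.1.1 k (by omega)

lemma VanishAbove.eMaxChain (h : VanishAbove N y) (n : ℕ) :
    VanishAbove N (eMaxChain a1 a2 y n) := by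
  induction n with
  | zero => exact h
  | succ n ih => exact ih.eMax (isI_idx _)

lemma sum_eMax {M : ℕ} (h : VanishAbove M y) (hi : IsI i) :
    ∑ l ∈ Finset.range M, eMax a1 a2 i y ((l : ℤ) + 1) =
      ∑ l ∈ Finset.range M, y ((l : ℤ) + 1) - tailEps a1 a2 1 i y := by
  have h1 := Finset.sum_range_sub' (fun l : ℕ => tailEps a1 a2 ((l : ℤ) + 1) i y) M
  rw [tailEps_eq_zero h hi (by omega : (M : ℤ) < M + 1)] at h1
  rw [Finset.sum_congr rfl fun (l : ℕ) _ =>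
    eMax_apply (a1 := a1) (a2 := a2) (i := i) (y := y) (by omega : 1 ≤ (l : ℤ) + 1),
    Finset.sum_sub_distrib]
  push_cast at h1
  rw [h1]
  simp

lemma XPlusMem.exists_eMaxChain_eq_zero (hc : CPos a1 a2) (hy : XPlusMem a1 a2 y) :
    ∃ J : ℕ, ∀ n, J ≤ n → HypCrystal.eMaxChain a1 a2 y n = fun _ => 0 := by
  obtain ⟨M, h⟩ := hy.exists_vanishAbove
  have key : ∀ m : ℕ, ∀ n : ℕ,
      ∑ l ∈ Finset.range M, HypCrystal.eMaxChain a1 a2 y n ((l : ℤ) + 1) ≤ m →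
        ∃ J, HypCrystal.eMaxChain a1 a2 y J = fun _ => 0 := by
    intro m
    induction m with
    | zero =>
      intro n hn
      have hz := hy.eMaxChain hc n
      refine ⟨n, funext fun k => ?_⟩
      by_cases hk : 1 ≤ k ∧ k ≤ M
      · have h0 : ∑ l ∈ Finset.range M, HypCrystal.eMaxChain a1 a2 y n ((l : ℤ) + 1) = 0 :=
          le_antisymm (by simpa using hn) (Finset.sum_nonneg fun l _ => hz.nonneg _)
        rw [Finset.sum_eq_zero_iff_of_nonneg fun l _ => hz.nonneg _] at h0
        have := h0 (k - 1).toNat (by rw [Finset.mem_range]; omega)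
        rwa [show (((k - 1).toNat : ℕ) : ℤ) + 1 = k by omega] at this
      · by_cases hk1 : 1 ≤ k
        · exact h.eMaxChain n k (by omega)
        · exact hz.1.1 k (by omega)
    | succ m ih =>
      intro n hn
      have hz := hy.eMaxChain hc n
      have hv := h.eMaxChain (a1 := a1) (a2 := a2) n
      have hI := isI_idx ((n : ℤ) + 1)
      have hs := sum_eMax (a1 := a1) (a2 := a2) hv hI
      have he := tailEps_nonneg (a1 := a1) (a2 := a2) hv hI 1
      by_cases h0 : tailEps a1 a2 1 (idx ((n : ℤ) + 1)) (HypCrystal.eMaxChain a1 a2 y n) = 0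
      · have hsame : HypCrystal.eMaxChain a1 a2 y (n + 1) = HypCrystal.eMaxChain a1 a2 y n :=
          eMax_eq_self hv hI h0
        have hI' := isI_idx (((n + 1 : ℕ) : ℤ) + 1)
        have hs' := sum_eMax (a1 := a1) (a2 := a2) hv hI'
        have he' := tailEps_nonneg (a1 := a1) (a2 := a2) hv hI' 1
        by_cases h0' : tailEps a1 a2 1 (idx (((n + 1 : ℕ) : ℤ) + 1))
            (HypCrystal.eMaxChain a1 a2 y n) = 0
        · refine ⟨n, hz.eq_zero fun i hi => ?_⟩
          have hne := idx_add_one_ne ((n : ℤ) + 1)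
          push_cast at h0'
          rcases hi with rfl | rfl <;> rcases isI_idx ((n : ℤ) + 1) with h3 | h3 <;>
            rcases isI_idx ((n : ℤ) + 1 + 1) with h4 | h4 <;> simp_all
        · refine ih (n + 2) ?_
          change ∑ l ∈ Finset.range M, HypCrystal.eMax a1 a2 (idx (((n + 1 : ℕ) : ℤ) + 1))
            (HypCrystal.eMaxChain a1 a2 y (n + 1)) ((l : ℤ) + 1) ≤ m
          rw [hsame, hs']
          push_cast at hn
          omega
      · refine ih (n + 1) ?_
        change ∑ l ∈ Finset.range M, HypCrystal.eMax a1 a2 (idx ((n : ℤ) + 1))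
            (HypCrystal.eMaxChain a1 a2 y n) ((l : ℤ) + 1) ≤ m
        rw [hs]
        push_cast at hn
        omega
  obtain ⟨J, hJ⟩ := key (∑ l ∈ Finset.range M, HypCrystal.eMaxChain a1 a2 y 0 ((l : ℤ) + 1)).toNat 0
    (by omega)
  refine ⟨J, fun n hn => ?_⟩
  induction n, hn using Nat.le_induction with
  | base => exact hJ
  | succ n _ ih => rw [HypCrystal.eMaxChain, ih, eMax_zero (isI_idx _)]

lemma eMaxChain_toNat_succ (hj : 1 ≤ j) :
    eMaxChain a1 a2 y (j + 1 - 1).toNat =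
      eMax a1 a2 (idx j) (eMaxChain a1 a2 y (j - 1).toNat) := by
  obtain ⟨l, rfl⟩ : ∃ l : ℕ, j = (l : ℤ) + 1 := ⟨(j - 1).toNat, by omega⟩
  have h1 : ((l : ℤ) + 1 + 1 - 1).toNat = l + 1 := by omega
  have h2 : ((l : ℤ) + 1 - 1).toNat = l := by omega
  rw [h1, h2, eMaxChain]

lemma tailString_apply (hj : 1 ≤ j) :
    tailString a1 a2 k y j = tailEps a1 a2 k (idx j) (eMaxChain a1 a2 y (j - 1).toNat) :=
  if_pos hj

lemma XPlusMem.exists_chain_bound (hc : CPos a1 a2) (hy : XPlusMem a1 a2 y) :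
    ∃ J : ℕ, (∀ n, J ≤ n → HypCrystal.eMaxChain a1 a2 y n = fun _ => 0) ∧
      ∀ k, 1 ≤ k → VanishAbove J (tailString a1 a2 k y) := by
  obtain ⟨J, hJ⟩ := hy.exists_eMaxChain_eq_zero hc
  refine ⟨J, hJ, fun k hk j hj => ?_⟩
  rw [tailString_apply (by omega), hJ _ (by omega)]
  exact tailEps_eq_zero (N := 0) (fun _ _ => rfl) (isI_idx j) (by omega)

/-- The weight of a truncation of `y` can be computed from its string. -/
lemma XPlusMem.tailPair_eMaxChain (hc : CPos a1 a2) (hy : XPlusMem a1 a2 y) (hk : 1 ≤ k)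
    (i j : ℤ) : 1 ≤ j → tailPair a1 a2 k i (HypCrystal.eMaxChain a1 a2 y (j - 1).toNat) =
      tailPair a1 a2 j i (tailString a1 a2 k y) := by
  obtain ⟨N, h⟩ := hy.exists_vanishAbove
  obtain ⟨J, hJ, hv⟩ := hy.exists_chain_bound hc
  refine downward_induction (P := fun j => 1 ≤ j →
    tailPair a1 a2 k i (HypCrystal.eMaxChain a1 a2 y (j - 1).toNat) =
      tailPair a1 a2 j i (tailString a1 a2 k y)) J ?_ ?_ j
  · intro j hj _
    rw [hJ _ (by omega), tailPair_eq_zero (hv k hk) hj]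
    exact tailPair_eq_zero (N := 0) (fun _ _ => rfl) (by omega) i
  · intro j ih hj
    rw [tailPair_step (hv k hk) j, ← ih (by omega), eMaxChain_toNat_succ hj,
      tailPair_eMax (h.eMaxChain _) j i hk, tailString_apply hj]
    ring

/-- Passing from truncation level `k + 1` to level `k` acts on strings by `f̃_{i_k}^{y_k}`. -/
lemma XPlusMem.fPiter_tailString (hc : CPos a1 a2) (hy : XPlusMem a1 a2 y) (hk : 1 ≤ k) :
    HypCrystal.fPiter a1 a2 (idx k) (y k).toNat (tailString a1 a2 (k + 1) y) =
      tailString a1 a2 k y := by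
  obtain ⟨N, h⟩ := hy.exists_vanishAbove
  obtain ⟨J, hJ, hv⟩ := hy.exists_chain_bound hc
  have hσ : ∀ j, 1 ≤ j → idx j = idx k → -sigmaP a1 a2 (tailString a1 a2 (k + 1) y) j =
      tailEps a1 a2 (k + 1) (idx k) (HypCrystal.eMaxChain a1 a2 y (j - 1).toNat) -
      tailPair a1 a2 (k + 1) (idx k) (HypCrystal.eMaxChain a1 a2 y (j - 1).toNat) := by
    intro j hj hjk
    rw [sigmaP_eq_sub (hv (k + 1) (by omega)), hjk,
      ← hy.tailPair_eMaxChain hc (by omega) (idx k) j hj, tailString_apply hj, hjk]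
    ring
  have hε : EpsNonpos a1 a2 (idx k) (tailString a1 a2 (k + 1) y) := by
    intro j hj hjk
    have h1 := hσ j hj hjk
    have hz := hy.eMaxChain hc (j - 1).toNat
    have hzv := h.eMaxChain (a1 := a1) (a2 := a2) (j - 1).toNat
    generalize HypCrystal.eMaxChain a1 a2 y (j - 1).toNat = z at *
    have h2 := le_tailEps (a1 := a1) (a2 := a2) hzv (k := k + 1) (j := k + 2) (by omega)
      (idx_add_two k)
    rw [tailPair_succ hzv, neg_mul] at h1
    have h3 := hz.2 (k + 1) (by omega)
    rw [show k + 1 - 1 = k by ring, show k + 1 + 1 = k + 2 by ring, cseq_step hk] at h3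
    have h4 : 0 ≤ aIdx a1 a2 k * z (k + 1) - z (k + 2) := by
      have h5 := mul_nonneg (hc.nonneg (k - 1)) (hz.nonneg (k + 1))
      refine nonneg_of_mul_nonneg_right (a := cseq a1 a2 k.toNat) ?_ (hc k hk)
      nlinarith
    omega
  have hG : IsSpread a1 a2 (idx k) (y k).toNat (tailString a1 a2 (k + 1) y)
      (fun j => HypCrystal.eMaxChain a1 a2 y (j - 1).toNat k) := by
    constructor
    · simp [HypCrystal.eMaxChain, hy.nonneg k]
    · intro j hj
      rw [eMaxChain_toNat_succ hj]
      split_ifs with hjk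
      · rw [hσ j hj hjk, hjk, eMax_apply hk, tailEps_step_self (h.eMaxChain _) rfl, sigmaP_eq]
        omega
      · exact eMax_of_ne (Ne.symm hjk)
  rw [IsSpread.fPiter_eq hε (hv (k + 1) (by omega)) (isI_idx k) _ hG]
  funext j
  simp only [addSpread]
  by_cases hj : 1 ≤ j
  · rw [if_pos hj, tailString_apply hj, tailString_apply hj, eMaxChain_toNat_succ hj,
      eMax_apply hk]
    by_cases hjk : idx k = idx j
    · ring
    · rw [tailEps_step_ne hjk]; ring
  · rw [if_neg hj, tailString, tailString, if_neg hj, if_neg hj]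

lemma starPChain_zero_of_vanishAbove {n : ℕ} (h : VanishAbove n x) (m : ℕ) :
    starPChain a1 a2 x (n + m) (fun _ => 0) = starPChain a1 a2 x n (fun _ => 0) := by
  induction m with
  | zero => rfl
  | succ m ih =>
    rw [← add_assoc, starPChain, h _ (by push_cast; omega)]
    exact ih

lemma starP_eq {n : ℕ} (h : VanishAbove n x) :
    starP a1 a2 x = starPChain a1 a2 x n (fun _ => 0) := by
  have hne : {N : ℕ | ∀ k : ℤ, (N : ℤ) < k → x k = 0}.Nonempty := ⟨n, h⟩
  have hb : VanishAbove (suppBoundP x) x := Nat.sInf_mem hne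
  have hle : suppBoundP x ≤ n := Nat.sInf_le h
  rw [starP, ← starPChain_zero_of_vanishAbove hb (n - suppBoundP x), Nat.add_sub_cancel' hle]

/-- The `∗`-operation computes strings. -/
lemma XPlusMem.starP_eq_tailString (hc : CPos a1 a2) (hy : XPlusMem a1 a2 y) :
    starP a1 a2 y = tailString a1 a2 1 y := by
  obtain ⟨N, h⟩ := hy.exists_vanishAbove
  have key : ∀ n : ℕ, HypCrystal.starPChain a1 a2 y n (tailString a1 a2 ((n : ℤ) + 1) y) =
      tailString a1 a2 1 y := by
    intro n
    induction n with
    | zero => simp [HypCrystal.starPChain]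
    | succ n ih =>
      rw [HypCrystal.starPChain]
      push_cast
      rw [hy.fPiter_tailString hc (by omega), ih]
  rw [starP_eq h, ← key N]
  congr 1
  funext j
  unfold tailString
  split_ifs
  · exact (tailEps_eq_zero (h.eMaxChain _) (isI_idx _) (by omega)).symm
  · rfl

lemma XPlusMem.starP_tailString (hc : CPos a1 a2) (hy : XPlusMem a1 a2 y) :
    starP a1 a2 (tailString a1 a2 1 y) = y := by
  obtain ⟨N, h⟩ := hy.exists_vanishAbove
  obtain ⟨J, hJ, hv⟩ := hy.exists_chain_bound hc
  have key : ∀ n : ℕ, HypCrystal.starPChain a1 a2 (tailString a1 a2 1 y) n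
      (HypCrystal.eMaxChain a1 a2 y n) = y := by
    intro n
    induction n with
    | zero => rfl
    | succ n ih =>
      rw [HypCrystal.starPChain, tailString_apply (by omega), HypCrystal.eMaxChain,
        show ((n : ℤ) + 1 - 1).toNat = n by omega, fPiter_eMax (h.eMaxChain n) (isI_idx _), ih]
  rw [starP_eq (hv 1 le_rfl), ← hJ J le_rfl, key J]

lemma XPlusMem.tailString_starP (hc : CPos a1 a2) (hx : XPlusMem a1 a2 x) :
    tailString a1 a2 1 (starP a1 a2 x) = x := by
  rw [← (xPlusMem_starP hc x).starP_eq_tailString hc, hx.starP_eq_tailString hc,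
    hx.starP_tailString hc]

section Gamma

lemma alphaR_betaR_props (ha1 : 1 ≤ a1) (ha2 : 1 ≤ a2) (ha : 4 < a1 * a2) :
    0 < alphaR a1 a2 ∧ 0 < betaR a1 a2 ∧ 1 < alphaR a1 a2 * betaR a1 a2 ∧
      alphaR a1 a2 * betaR a1 a2 = a1 * betaR a1 a2 - 1 ∧
      alphaR a1 a2 * betaR a1 a2 = a2 * alphaR a1 a2 - 1 := by
  have h1 : (0 : ℝ) < a1 := by exact_mod_cast ha1
  have h2 : (0 : ℝ) < a2 := by exact_mod_cast ha2
  have h3 : (4 : ℝ) < a1 * a2 := by exact_mod_cast ha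
  have hD : (0 : ℝ) ≤ (a1 : ℝ) ^ 2 * (a2 : ℝ) ^ 2 - 4 * a1 * a2 := by nlinarith
  have hs := Real.sq_sqrt hD
  have hs0 := Real.sqrt_nonneg ((a1 : ℝ) ^ 2 * (a2 : ℝ) ^ 2 - 4 * a1 * a2)
  unfold alphaR betaR
  generalize Real.sqrt ((a1 : ℝ) ^ 2 * (a2 : ℝ) ^ 2 - 4 * a1 * a2) = s at *
  have e1 : ((a1 : ℝ) * a2 + s) / (2 * a2) * (((a1 : ℝ) * a2 + s) / (2 * a1)) =
      (a1 * a2 + s) / 2 - 1 := by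
    field_simp
    nlinarith
  rw [e1]
  refine ⟨by positivity, by positivity, by linarith, ?_, ?_⟩ <;> field_simp

lemma gammaR_pos (ha1 : 1 ≤ a1) (ha2 : 1 ≤ a2) (ha : 4 < a1 * a2) (k : ℤ) :
    0 < gammaR a1 a2 k := by
  obtain ⟨h1, h2, -⟩ := alphaR_betaR_props ha1 ha2 ha
  unfold gammaR
  split_ifs <;> assumption

lemma gammaR_succ_mul (ha1 : 1 ≤ a1) (ha2 : 1 ≤ a2) (ha : 4 < a1 * a2) (k : ℤ) :
    gammaR a1 a2 (k + 1) * gammaR a1 a2 k = alphaR a1 a2 * betaR a1 a2 ∧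
      alphaR a1 a2 * betaR a1 a2 = aIdx a1 a2 k * gammaR a1 a2 k - 1 := by
  obtain ⟨-, -, -, h1, h2⟩ := alphaR_betaR_props ha1 ha2 ha
  rcases Int.emod_two_eq_zero_or_one k with hk | hk
  · have hk' : (k + 1) % 2 = 1 := by omega
    simp only [gammaR, aIdx, hk, hk', one_ne_zero, zero_ne_one, if_true, if_false]
    exact ⟨mul_comm _ _, h2⟩
  · have hk' : (k + 1) % 2 = 0 := by omega
    simp only [gammaR, aIdx, hk, hk', one_ne_zero, if_true, if_false]
    exact ⟨trivial, h1⟩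

/-- The defect `c_{j} - γ_j c_{j-1}`. -/
noncomputable def cDefect (a1 a2 j : ℤ) : ℝ :=
  cseq a1 a2 j.toNat - gammaR a1 a2 j * cseq a1 a2 (j - 1).toNat

lemma cDefect_succ (ha1 : 1 ≤ a1) (ha2 : 1 ≤ a2) (ha : 4 < a1 * a2) (hj : 1 ≤ j) :
    cDefect a1 a2 (j + 1) * gammaR a1 a2 j = cDefect a1 a2 j := by
  obtain ⟨h1, h2⟩ := gammaR_succ_mul ha1 ha2 ha j
  rw [h2] at h1
  unfold cDefect
  rw [cseq_step hj, show j + 1 - 1 = j by ring]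
  push_cast
  linear_combination (-(cseq a1 a2 j.toNat : ℝ)) * h1

lemma cDefect_pos (ha1 : 1 ≤ a1) (ha2 : 1 ≤ a2) (ha : 4 < a1 * a2) (hj : 1 ≤ j) :
    0 < cDefect a1 a2 j := by
  induction j, hj using Int.leInduction with
  | base => simp [cDefect, cseq]
  | succ j hj ih =>
    rw [← cDefect_succ ha1 ha2 ha hj] at ih
    exact pos_of_mul_pos_left ih (gammaR_pos ha1 ha2 ha j).le

lemma cPos (ha1 : 1 ≤ a1) (ha2 : 1 ≤ a2) (ha : 4 < a1 * a2) : CPos a1 a2 := by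
  intro j hj
  induction j, hj using Int.leInduction with
  | base => simp [cseq]
  | succ j hj ih =>
    have h1 := cDefect_pos ha1 ha2 ha (j := j + 1) (by omega)
    unfold cDefect at h1
    rw [show j + 1 - 1 = j by ring] at h1
    have h2 : (0 : ℝ) < cseq a1 a2 j.toNat := by exact_mod_cast ih
    have h3 := mul_pos (gammaR_pos ha1 ha2 ha (j + 1)) h2
    have h4 : (0 : ℝ) < cseq a1 a2 (j + 1).toNat := by linarith
    exact_mod_cast h4

lemma cDefect_add_two_mul (ha1 : 1 ≤ a1) (ha2 : 1 ≤ a2) (ha : 4 < a1 * a2) (hj : 1 ≤ j) (m : ℕ) :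
    (alphaR a1 a2 * betaR a1 a2) ^ m * cDefect a1 a2 (2 * m + j) = cDefect a1 a2 j := by
  induction m with
  | zero => simp
  | succ m ih =>
    have h1 := cDefect_succ ha1 ha2 ha (j := 2 * m + j) (by omega)
    have h2 := cDefect_succ ha1 ha2 ha (j := 2 * m + j + 1) (by omega)
    obtain ⟨h3, -⟩ := gammaR_succ_mul ha1 ha2 ha (2 * m + j)
    rw [← ih, ← h1, ← h2, pow_succ, ← h3,
      show 2 * ((m + 1 : ℕ) : ℤ) + j = 2 * m + j + 1 + 1 by push_cast; ring]
    ring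

lemma gammaR_add_two_mul (k : ℤ) (m : ℕ) : gammaR a1 a2 (2 * m + k) = gammaR a1 a2 k := by
  unfold gammaR
  rw [show (2 * (m : ℤ) + k) % 2 = k % 2 by omega]

/-- `c_j / c_{j-1}` tends to `γ_k` along `j ≡ k` modulo 2. -/
lemma gammaR_mul_sub_nonneg (ha1 : 1 ≤ a1) (ha2 : 1 ≤ a2) (ha : 4 < a1 * a2) (hk : 1 ≤ k)
    {u v : ℤ} (huv : ∀ m : ℕ, 0 ≤ cseq a1 a2 (2 * m + k).toNat * u -
      cseq a1 a2 (2 * m + k - 1).toNat * v) :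
    0 ≤ gammaR a1 a2 k * (u : ℝ) - (v : ℝ) := by
  by_contra! hneg
  obtain ⟨-, -, hq, -⟩ := alphaR_betaR_props ha1 ha2 ha
  have bound : ∀ m : ℕ, 1 ≤ m → (alphaR a1 a2 * betaR a1 a2) ^ m * (v - gammaR a1 a2 k * u) ≤
      cDefect a1 a2 k * u := by
    intro m hm
    have h1 : (0 : ℝ) ≤ cseq a1 a2 (2 * m + k).toNat * u -
      cseq a1 a2 (2 * m + k - 1).toNat * v := by exact_mod_cast huv m
    have h2 : (1 : ℝ) ≤ cseq a1 a2 (2 * m + k - 1).toNat := by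
      exact_mod_cast cPos ha1 ha2 ha (2 * m + k - 1) (by omega)
    have h3 : v - gammaR a1 a2 k * u ≤ cDefect a1 a2 (2 * m + k) * u := by
      unfold cDefect
      rw [gammaR_add_two_mul]
      nlinarith
    rw [← cDefect_add_two_mul ha1 ha2 ha hk m, mul_assoc]
    exact mul_le_mul_of_nonneg_left h3 (by positivity)
  obtain ⟨m, hm⟩ := pow_unbounded_of_one_lt
    (cDefect a1 a2 k * u / (v - gammaR a1 a2 k * u)) hq
  rw [div_lt_iff₀ (by linarith)] at hm
  have h4 := bound (m + 1) (by omega)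
  have h5 := mul_le_mul_of_nonneg_right (pow_le_pow_right₀ hq.le (Nat.le_add_right m 1))
    (by linarith : (0 : ℝ) ≤ v - gammaR a1 a2 k * u)
  linarith

end Gamma

/-! ### The operators on `Z_ι(μ)` for elements with trivial negative part -/

section TensorZero

variable {μ : ℤ × ℤ}

lemma XPlusMem.pairW_wtZ (hy : XPlusMem a1 a2 y) (hi : IsI i) :
    pairW (wtZ a1 a2 μ y) i = pairW μ i - tailPair a1 a2 1 i y := by
  have key : ∀ j : ℤ, ∀ c : ℤ, (1 ≤ j → c = pairJI a1 a2 j i) →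
      y j * c = if 1 ≤ j then pairJI a1 a2 j i * y j else 0 := by
    intro j c hcj
    split_ifs with hj
    · rw [hcj hj, mul_comm]
    · rw [hy.1.1 j (by omega), zero_mul]
  unfold tailPair
  rcases hi with rfl | rfl
  · simp only [pairW, wtZ, wtOf, if_true, Prod.fst_add, sub_eq_add_neg]
    congr 3
    funext j
    refine key j _ fun _ => ?_
    unfold alphaOf pairJI idx
    split_ifs <;> simp_all
  · simp only [pairW, wtZ, wtOf, if_false, Prod.snd_add, sub_eq_add_neg, OfNat.ofNat_ne_one]
    congr 3
    funext j
    refine key j _ fun _ => ?_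
    unfold alphaOf pairJI idx
    split_ifs <;> simp_all

lemma XPlusMem.sigmaZ_nonpos (hy : XPlusMem a1 a2 y) (hk : k ≤ 0) :
    sigmaZ a1 a2 μ y k = -pairW (wtZ a1 a2 μ y) (idx k) := by
  rw [sigmaZ, if_neg (by omega), sigmaM, hy.1.1 k hk, finsum_eq_zero_of_forall_eq_zero]
  · ring
  · intro j
    split_ifs with hj
    · rw [hy.1.1 j (by omega), mul_zero]
    · rfl

lemma XPlusMem.epsZ_eq (hy : XPlusMem a1 a2 y) (hi : IsI i) :
    epsZ a1 a2 μ y i = max (tailEps a1 a2 1 i y) (-pairW (wtZ a1 a2 μ y) i) := by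
  obtain ⟨N, h⟩ := hy.exists_vanishAbove
  apply IsGreatest.csSup_eq
  constructor
  · rcases max_choice (tailEps a1 a2 1 i y) (-pairW (wtZ a1 a2 μ y) i) with hm | hm <;> rw [hm]
    · obtain ⟨j, hj, hji, hs⟩ := exists_eq_tailEps (a1 := a1) (a2 := a2) h hi 1
      exact ⟨j, hji, by rw [sigmaZ, if_pos hj, hs]⟩
    · obtain ⟨j, hj, hji⟩ : ∃ j, j ≤ 0 ∧ idx j = i := by
        rcases hi with rfl | rfl
        · exact ⟨-1, by omega, rfl⟩
        · exact ⟨0, le_rfl, rfl⟩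
      exact ⟨j, hji, by rw [hy.sigmaZ_nonpos hj, hji]⟩
  · rintro s ⟨j, hji, rfl⟩
    by_cases hj : 1 ≤ j
    · rw [sigmaZ, if_pos hj]
      exact le_max_of_le_left (le_tailEps h hj hji)
    · rw [hy.sigmaZ_nonpos (by omega), hji]
      exact le_max_right _ _

lemma XPlusMem.epsNonpos_of_eZ (hy : XPlusMem a1 a2 y) (hi : IsI i)
    (he : eZ a1 a2 μ i y = none) : EpsNonpos a1 a2 i y := by
  obtain ⟨N, h⟩ := hy.exists_vanishAbove
  intro j hj hji
  have h1 : ¬ 0 < epsZ a1 a2 μ y i := by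
    intro hpos
    rw [eZ, if_pos hpos] at he
    exact absurd he (by simp)
  rw [hy.epsZ_eq hi] at h1
  have := le_tailEps (a1 := a1) (a2 := a2) h hj hji
  omega

lemma XPlusMem.fZ_eq (hy : XPlusMem a1 a2 y) (hi : IsI i)
    (hpos : 0 < tailEps a1 a2 1 i y + pairW (wtZ a1 a2 μ y) i) :
    fZ a1 a2 μ i y = some (HypCrystal.fP a1 a2 i y) := by
  have hE : epsZ a1 a2 μ y i = tailEps a1 a2 1 i y := by rw [hy.epsZ_eq hi]; omega
  have hk : kminZ a1 a2 μ y i = kminP a1 a2 y i := by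
    unfold kminZ kminP
    congr 1
    ext k
    rw [Set.mem_ofPred_eq, Set.mem_ofPred_eq, hE]
    by_cases hk : 1 ≤ k
    · rw [sigmaZ, if_pos hk]
      exact ⟨fun hh => ⟨hk, hh⟩, fun hh => hh.2⟩
    · constructor
      · rintro ⟨hki, hs⟩
        rw [hy.sigmaZ_nonpos (by omega), hki] at hs
        omega
      · exact fun hh => absurd hh.1 hk
  rw [fZ, phiZ, hE, if_pos hpos, hk, HypCrystal.fP]

lemma XPlusMem.tailPair_fPiter (hc : CPos a1 a2) (hy : XPlusMem a1 a2 y) (l i : ℤ)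
    (hε : EpsNonpos a1 a2 (idx l) y) (m : ℕ) :
    tailPair a1 a2 1 i (HypCrystal.fPiter a1 a2 (idx l) m y) =
      tailPair a1 a2 1 i y + pairJI a1 a2 l i * m := by
  obtain ⟨N, h⟩ := hy.exists_vanishAbove
  obtain ⟨M, hM⟩ := (hy.fPiter hc (isI_idx l) m).exists_vanishAbove
  have h1 := tailPair_eMax (a1 := a1) (a2 := a2) hM l i le_rfl
  rw [eMax_fPiter hε h (isI_idx l), tailEps_fPiter hε h (isI_idx l)] at h1
  rw [h1]; ring

lemma XPlusMem.siO_eq (hc : CPos a1 a2) (hy : XPlusMem a1 a2 y) (l : ℤ)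
    (hε : EpsNonpos a1 a2 (idx l) y) (hw : 0 ≤ pairW (wtZ a1 a2 μ y) (idx l)) :
    SiO a1 a2 μ (idx l) (some y) =
      some (HypCrystal.fPiter a1 a2 (idx l) (pairW (wtZ a1 a2 μ y) (idx l)).toNat y) := by
  obtain ⟨N, h⟩ := hy.exists_vanishAbove
  have key : ∀ m : ℕ, (m : ℤ) ≤ pairW (wtZ a1 a2 μ y) (idx l) →
      fZiterO a1 a2 μ (idx l) m (some y) = some (HypCrystal.fPiter a1 a2 (idx l) m y) := by
    intro m
    induction m with
    | zero => intro _; rfl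
    | succ m ih =>
      intro hm
      push_cast at hm
      have hs : fZiterO a1 a2 μ (idx l) (m + 1) (some y) =
          (fZiterO a1 a2 μ (idx l) m (some y)).bind (fZ a1 a2 μ (idx l)) :=
        Function.iterate_succ_apply' _ _ _
      have hym := hy.fPiter hc (isI_idx l) m
      rw [hs, ih (by omega), Option.bind_some, fPiter_succ, hym.fZ_eq (isI_idx l)]
      rw [hy.pairW_wtZ (isI_idx l)] at hm
      rw [hym.pairW_wtZ (isI_idx l), tailEps_fPiter hε h (isI_idx l),
        hy.tailPair_fPiter hc l _ hε, pairJI_self]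
      omega
  rw [SiO, Option.bind_some, if_pos hw, key _ (by omega)]

end TensorZero

/-! ### The element `x*` and its images under the Weyl group -/

lemma starM_zero : starM a1 a2 (fun _ => 0) = fun _ => 0 := by
  have key : ∀ n : ℕ, starMChain a1 a2 (fun _ => 0) n (fun _ => 0) = fun _ => 0 := by
    intro n
    induction n with
    | zero => rfl
    | succ n ih => exact ih
  exact key _

lemma XPlusMem.posPart_eq (hx : XPlusMem a1 a2 x) : posPart x = x := by
  funext k
  unfold HypCrystal.posPart
  split_ifs with hk
  · rfl
  · rw [hx.1.1 k (by omega)]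

lemma XPlusMem.negPart_eq (hx : XPlusMem a1 a2 x) : negPart x = fun _ => 0 := by
  funext k
  unfold HypCrystal.negPart
  split_ifs with hk
  · rw [hx.1.1 k hk]
  · rfl

lemma XPlusMem.xstarFun_eq (hc : CPos a1 a2) (hx : XPlusMem a1 a2 x) :
    xstarFun a1 a2 x = starP a1 a2 x := by
  rw [xstarFun, hx.posPart_eq, hx.negPart_eq, starM_zero]
  funext k
  unfold combine
  split_ifs with hk
  · rfl
  · rw [(xPlusMem_starP hc x).1.1 k (by omega)]

lemma XPlusMem.tailPair_starP (hc : CPos a1 a2) (hx : XPlusMem a1 a2 x) (i : ℤ) :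
    tailPair a1 a2 1 i (starP a1 a2 x) = tailPair a1 a2 1 i x := by
  rw [hx.starP_eq_tailString hc, ← hx.tailPair_eMaxChain hc le_rfl i 1 le_rfl]
  rfl

lemma XPlusMem.wtZ_mustar (hc : CPos a1 a2) (hx : XPlusMem a1 a2 x) (lam : ℤ × ℤ) :
    wtZ a1 a2 (mustar a1 a2 lam x) (starP a1 a2 x) = -lam := by
  have hs := xPlusMem_starP hc x
  have hw : ∀ i, IsI i → pairW (wtZ a1 a2 0 (starP a1 a2 x)) i = pairW (wtZ a1 a2 0 x) i :=
    fun i hi => by rw [hs.pairW_wtZ hi, hx.pairW_wtZ hi, hx.tailPair_starP hc]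
  have h1 := hw 1 (Or.inl rfl)
  have h2 := hw 2 (Or.inr rfl)
  simp only [pairW, wtZ, zero_add, if_true, OfNat.ofNat_ne_one, if_false] at h1 h2
  have h0 : wtOf a1 a2 (fun _ => 0) = 0 := by simp [wtOf]
  rw [wtZ, mustar, hx.posPart_eq, hx.negPart_eq, h0, Prod.ext h1 h2]
  abel

lemma eMaxChain_add_two (y : ℤ → ℤ) (n : ℕ) :
    eMaxChain a1 a2 y (n + 2) = eMaxChain a1 a2 (eMax a1 a2 2 (eMax a1 a2 1 y)) n := by
  induction n with
  | zero => rfl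
  | succ n ih =>
    rw [show n + 1 + 2 = n + 2 + 1 by ring, eMaxChain, ih, eMaxChain]
    push_cast
    rw [show (n : ℤ) + 2 + 1 = n + 1 + 2 by ring, idx_add_two]

lemma eMaxChain_two_mul_add (y : ℤ → ℤ) (m n : ℕ) :
    eMaxChain a1 a2 y (2 * m + n) = eMaxChain a1 a2 (eMaxChain a1 a2 y (2 * m)) n := by
  induction n with
  | zero => rfl
  | succ n ih =>
    rw [← add_assoc, eMaxChain, ih, eMaxChain]
    congr 1
    unfold idx
    push_cast
    rw [show (2 * (m : ℤ) + n + 1) % 2 = ((n : ℤ) + 1) % 2 by omega]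

lemma idx_two_mul_add (m : ℕ) (k : ℤ) : idx (2 * m + k) = idx k := by
  unfold idx
  rw [show (2 * (m : ℤ) + k) % 2 = k % 2 by omega]

lemma tailString_two_mul_add (y : ℤ → ℤ) (m : ℕ) (hk : 1 ≤ k) :
    tailString a1 a2 1 y (2 * m + k) = tailString a1 a2 1 (eMaxChain a1 a2 y (2 * m)) k := by
  rw [tailString_apply (by omega), tailString_apply hk, idx_two_mul_add,
    show (2 * (m : ℤ) + k - 1).toNat = 2 * m + (k - 1).toNat by omega, eMaxChain_two_mul_add]

/-- Condition on a weight `-Q Λ_1 + P Λ_2` which guarantees that reflecting alternately in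
`α_2` and `α_1` always lowers the weight. -/
structure IsLowering (a1 a2 P Q : ℤ) : Prop where
  pos : 0 < P
  generic : 2 ≤ a1 → 2 ≤ a2 → Q ≤ (a1 - 1) * P
  left : a1 = 1 → 2 * Q ≤ P
  right : a2 = 1 → Q ≤ (a1 - 2) * P

lemma IsLowering.step {P Q : ℤ} (ha1 : 1 ≤ a1) (ha2 : 1 ≤ a2) (ha : 4 < a1 * a2)
    (h : IsLowering a1 a2 P Q) :
    0 < a1 * P - Q ∧ IsLowering a1 a2 (a2 * (a1 * P - Q) - P) (a1 * P - Q) := by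
  obtain ⟨hP, hg, hl, hr⟩ := h
  rcases ha1.eq_or_lt with rfl | h1
  · have h5 : 5 ≤ a2 := by omega
    have hq := hl rfl
    have hlow : P ≤ 2 * (1 * P - Q) := by omega
    have h3 : 5 * (1 * P - Q) ≤ a2 * (1 * P - Q) :=
      mul_le_mul_of_nonneg_right h5 (by omega)
    exact ⟨by omega, by omega, by omega, by intro; omega, by omega⟩
  rcases ha2.eq_or_lt with rfl | h2
  · have h5 : 5 ≤ a1 := by omega
    have hq := hr rfl
    have hlow : 2 * P ≤ a1 * P - Q := by linarith
    have hR : P ≤ 1 * (a1 * P - Q) - P := by omega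
    refine ⟨by omega, by omega, by omega, by omega, fun _ => ?_⟩
    have h3 := mul_le_mul_of_nonneg_right (by omega : 3 ≤ a1 - 2)
      (by omega : 0 ≤ 1 * (a1 * P - Q) - P)
    omega
  · have hq := hg (by omega) (by omega)
    have hlow : P ≤ a1 * P - Q := by linarith
    rcases (by omega : a2 = 2 ∨ 3 ≤ a2) with rfl | h3
    · have h4 := mul_le_mul_of_nonneg_right (by nlinarith : 2 ≤ a1 - 1)
        (by omega : 0 ≤ 2 * (a1 * P - Q) - P)
      exact ⟨by omega, by omega, fun _ _ => by omega, by omega, by omega⟩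
    · have h4 := mul_le_mul_of_nonneg_right h3 (by omega : 0 ≤ a1 * P - Q)
      have h5 := mul_le_mul_of_nonneg_right (by omega : 1 ≤ a1 - 1)
        (by omega : 0 ≤ a2 * (a1 * P - Q) - P)
      exact ⟨by omega, by omega, fun _ _ => by omega, by omega, by omega⟩

/-- An extremal element `y` can be recovered by lowering it along `(S_1 S_2)^m` and then removing
`2 m` maximal strings. -/
lemma XPlusMem.exists_foldr_siO (ha1 : 1 ≤ a1) (ha2 : 1 ≤ a2) (ha : 4 < a1 * a2)
    {μ : ℤ × ℤ} (hy : XPlusMem a1 a2 y) (hext : Extremal a1 a2 μ y)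
    (hw : IsLowering a1 a2 (pairW (wtZ a1 a2 μ y) 2) (-pairW (wtZ a1 a2 μ y) 1)) (m : ℕ) :
    ∃ js : List ℤ, ∃ b : ℤ → ℤ, (∀ j ∈ js, IsI j) ∧
      js.foldr (SiO a1 a2 μ) (some y) = some b ∧ XPlusMem a1 a2 b ∧
      IsLowering a1 a2 (pairW (wtZ a1 a2 μ b) 2) (-pairW (wtZ a1 a2 μ b) 1) ∧
      HypCrystal.eMaxChain a1 a2 b (2 * m) = y := by
  have hc := cPos ha1 ha2 ha
  have I1 : IsI 1 := Or.inl rfl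
  have I2 : IsI 2 := Or.inr rfl
  have hε : ∀ (js : List ℤ) (b : ℤ → ℤ) (i : ℤ), (∀ j ∈ js, IsI j) →
      js.foldr (SiO a1 a2 μ) (some y) = some b → XPlusMem a1 a2 b → IsI i →
      0 ≤ pairW (wtZ a1 a2 μ b) i → EpsNonpos a1 a2 i b := by
    intro js b i hjs hb hbX hi hpos
    obtain ⟨b', hb', hi'⟩ := hext js hjs
    obtain rfl : b = b' := Option.some.inj (hb.symm.trans hb')
    exact hbX.epsNonpos_of_eZ hi ((hi' i hi).1 hpos)
  induction m with
  | zero => exact ⟨[], y, by simp, rfl, hy, hw, rfl⟩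
  | succ m ih =>
    obtain ⟨js, b, hjs, hb, hbX, hbw, hbc⟩ := ih
    obtain ⟨N, hN⟩ := hbX.exists_vanishAbove
    obtain ⟨hpos, hnext⟩ := hbw.step ha1 ha2 ha
    have hP := hbw.pos
    have e2 := hε js b 2 hjs hb hbX I2 hP.le
    have s2 := hbX.siO_eq hc 2 e2 hP.le
    have t2 := fun i => hbX.tailPair_fPiter hc 2 i e2 (pairW (wtZ a1 a2 μ b) 2).toNat
    have hdX := hbX.fPiter hc I2 (pairW (wtZ a1 a2 μ b) 2).toNat
    have hd1 := eMax_fPiter e2 hN I2 (pairW (wtZ a1 a2 μ b) 2).toNat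
    change SiO a1 a2 μ 2 (some b) =
      some (HypCrystal.fPiter a1 a2 2 (pairW (wtZ a1 a2 μ b) 2).toNat b) at s2
    change ∀ i, tailPair a1 a2 1 i (HypCrystal.fPiter a1 a2 2 _ b) = _ at t2
    generalize HypCrystal.fPiter a1 a2 2 (pairW (wtZ a1 a2 μ b) 2).toNat b = d at *
    have p1 : pairJI a1 a2 2 1 = -a1 := rfl
    have p2 : pairJI a1 a2 2 2 = 2 := rfl
    have q1 : pairJI a1 a2 1 1 = 2 := rfl
    have q2 : pairJI a1 a2 1 2 = -a2 := rfl
    have wd1 : pairW (wtZ a1 a2 μ d) 1 =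
        a1 * pairW (wtZ a1 a2 μ b) 2 - -pairW (wtZ a1 a2 μ b) 1 := by
      rw [hdX.pairW_wtZ I1, t2, hbX.pairW_wtZ I1, p1, Int.toNat_of_nonneg hP.le]
      ring
    have wd2 : pairW (wtZ a1 a2 μ d) 2 = -pairW (wtZ a1 a2 μ b) 2 := by
      rw [hdX.pairW_wtZ I2, t2, p2, Int.toNat_of_nonneg hP.le, hbX.pairW_wtZ I2]
      ring
    rw [← wd1] at hpos
    have hjs2 : ∀ j ∈ 2 :: js, IsI j := by
      simpa using ⟨I2, hjs⟩
    have hd : (2 :: js).foldr (SiO a1 a2 μ) (some y) = some d := by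
      rw [List.foldr_cons, hb, s2]
    obtain ⟨M, hM⟩ := hdX.exists_vanishAbove
    have e1 := hε (2 :: js) d 1 hjs2 hd hdX I1 hpos.le
    have s1 := hdX.siO_eq hc 1 e1 hpos.le
    have t1 := fun i => hdX.tailPair_fPiter hc 1 i e1 (pairW (wtZ a1 a2 μ d) 1).toNat
    have hgX := hdX.fPiter hc I1 (pairW (wtZ a1 a2 μ d) 1).toNat
    have hg1 := eMax_fPiter e1 hM I1 (pairW (wtZ a1 a2 μ d) 1).toNat
    change SiO a1 a2 μ 1 (some d) =
      some (HypCrystal.fPiter a1 a2 1 (pairW (wtZ a1 a2 μ d) 1).toNat d) at s1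
    change ∀ i, tailPair a1 a2 1 i (HypCrystal.fPiter a1 a2 1 _ d) = _ at t1
    generalize HypCrystal.fPiter a1 a2 1 (pairW (wtZ a1 a2 μ d) 1).toNat d = g at *
    have wg1 : pairW (wtZ a1 a2 μ g) 1 = -pairW (wtZ a1 a2 μ d) 1 := by
      rw [hgX.pairW_wtZ I1, t1, q1, Int.toNat_of_nonneg hpos.le, hdX.pairW_wtZ I1]
      ring
    have wg2 : pairW (wtZ a1 a2 μ g) 2 =
        a2 * pairW (wtZ a1 a2 μ d) 1 - pairW (wtZ a1 a2 μ b) 2 := by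
      rw [hgX.pairW_wtZ I2, t1, q2, Int.toNat_of_nonneg hpos.le]
      rw [hdX.pairW_wtZ I2] at wd2
      linear_combination wd2
    refine ⟨1 :: 2 :: js, g, by simpa using ⟨I1, I2, hjs⟩, ?_, hgX, ?_, ?_⟩
    · rw [List.foldr_cons, hd, s1]
    · rwa [wg1, wg2, wd1, neg_neg]
    · rw [mul_add, mul_one, eMaxChain_add_two, hg1, hd1, hbc]

end HypCrystal

open HypCrystal in
theorem extremal_implies_gamma_x_ineq
    (a1 a2 : ℤ) (ha1 : 1 ≤ a1) (ha2 : 1 ≤ a2) (ha : 4 < a1 * a2)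
    (k1 k2 : ℤ) (hk1 : 0 < k1) (hk2 : 0 < k2)
    (hreg : 2 ≤ a1 → 2 ≤ a2 →
      (k2 ≤ k1 ∧ k1 < (a1 - 1) * k2) ∨ (k1 < k2 ∧ k2 ≤ (a2 - 1) * k1))
    (hdeg1 : a1 = 1 → 2 * k1 ≤ k2 ∧ k2 ≤ (a2 - 2) * k1)
    (hdeg2 : a2 = 1 → 2 * k2 ≤ k1 ∧ k1 ≤ (a1 - 2) * k2)
    (x : ℤ → ℤ) (hx : XPlusMem a1 a2 x)
    (hext : Extremal a1 a2 (mustar a1 a2 (lamW k1 k2) x) (xstarFun a1 a2 x)) :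
    ∀ k : ℤ, 1 ≤ k →
      0 ≤ gammaR a1 a2 k * (x k : ℝ) - (x (k + 1) : ℝ) := by
  have hc := cPos ha1 ha2 ha
  have hs := xPlusMem_starP hc x
  have hwt := hx.wtZ_mustar hc (lamW k1 k2)
  rw [hx.xstarFun_eq hc] at hext
  have hlow : IsLowering a1 a2
      (pairW (wtZ a1 a2 (mustar a1 a2 (lamW k1 k2) x) (starP a1 a2 x)) 2)
      (-pairW (wtZ a1 a2 (mustar a1 a2 (lamW k1 k2) x) (starP a1 a2 x)) 1) := by
    rw [hwt]
    simp only [pairW, lamW, OfNat.ofNat_ne_one, if_false, if_true, Prod.neg_mk, neg_neg]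
    refine ⟨hk2, fun h1 h2 => ?_, fun h => (hdeg1 h).1, fun h => (hdeg2 h).2⟩
    rcases hreg h1 h2 with h | h
    · exact h.2.le
    · have := mul_le_mul_of_nonneg_right (by omega : 1 ≤ a1 - 1) hk2.le
      omega
  intro k hk
  refine gammaR_mul_sub_nonneg ha1 ha2 ha hk fun m => ?_
  obtain ⟨-, b, -, -, hbX, -, hb⟩ := hs.exists_foldr_siO ha1 ha2 ha hext hlow m
  have hmem := xPlusMem_starP hc b
  rw [hbX.starP_eq_tailString hc] at hmem
  have h := hmem.2 (2 * m + k) (by omega)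
  rwa [add_assoc, tailString_two_mul_add b m hk, tailString_two_mul_add b m (by omega), hb,
    hx.tailString_starP hc] at h
end

section
/- (1) If there exists n ∈ ℤ with 0 < p_{2n} ≤ p_{2n+2}, then 0 < p_{2m} ≤ p_{2m+2} for all m ≥ n. (2) If there exists n ∈ ℤ with 0 < p_{2n} ≤ p_{2n−2}, then 0 < p_{2m} ≤ p_{2m−2} for all m ≤ n. -/
open Filter Function

namespace HypCrystal

/-- The three-term recurrence of the two-sided sequence, uniformly in the index. -/
theorem pseq_add_two (a1 a2 k1 k2 m : ℤ) :
    pseq a1 a2 k1 k2 (m + 2) =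
      (if m % 2 = 0 then a2 else a1) * pseq a1 a2 k1 k2 (m + 1) - pseq a1 a2 k1 k2 m := by
  obtain ⟨n, rfl⟩ | rfl | ⟨n, rfl⟩ :
      (∃ n : ℕ, m = n) ∨ m = -1 ∨ ∃ n : ℕ, m = -(n : ℤ) - 2 := by
    rcases le_or_gt 0 m with h | h
    · exact Or.inl ⟨m.toNat, by omega⟩
    · by_cases h1 : m = -1
      · exact Or.inr (Or.inl h1)
      · exact Or.inr (Or.inr ⟨(-m - 2).toNat, by omega⟩)
  · have e2 : ((n : ℤ) + 2).toNat = n + 2 := by omega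
    have e1 : ((n : ℤ) + 1).toNat = n + 1 := by omega
    have hc : ((n : ℤ) % 2 = 0) ↔ n % 2 = 0 := by omega
    simp only [pseq, if_pos (show (0 : ℤ) ≤ n + 2 by omega),
      if_pos (show (0 : ℤ) ≤ n + 1 by omega), if_pos (show (0 : ℤ) ≤ n by omega), e2, e1,
      Int.toNat_natCast, hc, ppos]
  · simp [pseq, ppos, pneg]
  · have neg_eq (j : ℕ) : pseq a1 a2 k1 k2 (-(j : ℤ)) = pneg a1 a2 k1 k2 j := by
      cases j with
      | zero => simp [pseq, ppos, pneg]
      | succ j => rw [pseq, if_neg (by omega)]; congr 1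
    have e0 : -(n : ℤ) - 2 = -((n + 2 : ℕ) : ℤ) := by push_cast; ring
    have e1 : -((n + 2 : ℕ) : ℤ) + 1 = -((n + 1 : ℕ) : ℤ) := by push_cast; ring
    have e2 : -((n + 2 : ℕ) : ℤ) + 2 = -(n : ℤ) := by push_cast; ring
    have hc : (-((n + 2 : ℕ) : ℤ) % 2 = 0) ↔ (n + 2) % 2 = 0 := by omega
    simp only [e0, e1, e2, neg_eq, hc, pneg]
    ring

/-- For `a2 = 1` the even-indexed terms satisfy a recurrence with constant coefficients. -/
theorem pseq_even_add_pseq_even (a1 k l n : ℤ) :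
    pseq a1 1 k l (2 * n + 2) + pseq a1 1 k l (2 * n - 2) =
      (a1 - 2) * pseq a1 1 k l (2 * n) := by
  have h0 := pseq_add_two a1 1 k l (2 * n)
  have h1 := pseq_add_two a1 1 k l (2 * n - 1)
  have h2 := pseq_add_two a1 1 k l (2 * n - 2)
  rw [if_pos (by omega)] at h0 h2
  rw [if_neg (by omega)] at h1
  ring_nf at h0 h1 h2 ⊢
  linarith

end HypCrystal

open HypCrystal in
theorem pseq_even_monotone_of_a2_eq_one
    (a1 : ℤ) (ha1 : 5 ≤ a1) (k l : ℤ) :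
    (∀ n : ℤ, (0 < pseq a1 1 k l (2 * n) ∧ pseq a1 1 k l (2 * n) ≤ pseq a1 1 k l (2 * n + 2)) →
      ∀ m : ℤ, n ≤ m → 0 < pseq a1 1 k l (2 * m) ∧ pseq a1 1 k l (2 * m) ≤ pseq a1 1 k l (2 * m + 2)) ∧
    (∀ n : ℤ, (0 < pseq a1 1 k l (2 * n) ∧ pseq a1 1 k l (2 * n) ≤ pseq a1 1 k l (2 * n - 2)) →
      ∀ m : ℤ, m ≤ n → 0 < pseq a1 1 k l (2 * m) ∧ pseq a1 1 k l (2 * m) ≤ pseq a1 1 k l (2 * m - 2)) := by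
  constructor
  · intro n hn m hm
    induction m, hm using Int.leInduction with
    | base => exact hn
    | succ m _ ih =>
      obtain ⟨hpos, hle⟩ := ih
      have h := pseq_even_add_pseq_even a1 k l (m + 1)
      rw [show 2 * (m + 1) - 2 = 2 * m by ring] at h
      rw [show 2 * m + 2 = 2 * (m + 1) by ring] at hle
      exact ⟨by linarith, by nlinarith⟩
  · intro n hn m hm
    induction m, hm using Int.leInductionDown with
    | base => exact hn
    | pred m _ ih =>
      obtain ⟨hpos, hle⟩ := ih
      have h := pseq_even_add_pseq_even a1 k l (m - 1)
      rw [show 2 * (m - 1) + 2 = 2 * m by ring] at h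
      rw [show 2 * m - 2 = 2 * (m - 1) by ring] at hle
      exact ⟨by linarith, by nlinarith⟩
end
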